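/- arXiv:0812.4132 — 11 statements merged into one kernel-verified Lean document; each statement's English description precedes it below -/
import Mathlib

section
/- Let L be an even unimodular lattice and M ⊆ L a primitive submodule on which the bilinear form is nondegenerate, with orthogonal complement M^⊥. Then the form is also nondegenerate on M^⊥, and there exists a group isomorphism λ : D_M → D_{M^⊥} such that: (i) for every x ∈ M^∨ there exists y ∈ (M^⊥)^∨ with x + y ∈ L (inside L ⊗ ℚ) and λ([x]) = [y]; (ii) q_{M^⊥}(λ(ξ)) = −q_M(ξ) in ℚ/2ℤ for every ξ ∈ D_M. -/
open Submodule

/-- The orthogonal complement `M^⊥ = {l ∈ L : ⟨l, m⟩ = 0 for all m ∈ M}` of a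
submodule `M` of a lattice `L`, with respect to a bilinear form `Φ`. -/
def perpLat {V : Type} [AddCommGroup V] [Module ℚ V]
    (Φ : V →ₗ[ℚ] V →ₗ[ℚ] ℚ) (L M : Submodule ℤ V) : Submodule ℤ V where
  carrier := {x | x ∈ L ∧ ∀ m ∈ M, Φ x m = 0}
  zero_mem' := ⟨L.zero_mem, fun m _ => by simp⟩
  add_mem' := by
    rintro x y ⟨hxL, hx⟩ ⟨hyL, hy⟩
    refine ⟨L.add_mem hxL hyL, fun m hm => ?_⟩
    simp [hx m hm, hy m hm]
  smul_mem' := by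
    rintro c x ⟨hxL, hx⟩
    refine ⟨L.smul_mem c hxL, fun m hm => ?_⟩
    rw [← Int.cast_smul_eq_zsmul ℚ c x, map_smul]
    simp [hx m hm]

/-- The dual lattice `M^∨ = {x ∈ M ⊗ ℚ : ⟨x, m⟩ ∈ ℤ for all m ∈ M}` of a
`ℤ`-submodule `M` of a `ℚ`-vector space, with respect to a bilinear form `Φ`. -/
def dualLat {V : Type} [AddCommGroup V] [Module ℚ V]
    (Φ : V →ₗ[ℚ] V →ₗ[ℚ] ℚ) (M : Submodule ℤ V) : Submodule ℤ V where
  carrier := {x | x ∈ span ℚ (M : Set V) ∧ ∀ m ∈ M, ∃ k : ℤ, Φ x m = (k : ℚ)}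
  zero_mem' := ⟨zero_mem _, fun m _ => ⟨0, by simp⟩⟩
  add_mem' := by
    rintro x y ⟨hxs, hx⟩ ⟨hys, hy⟩
    refine ⟨add_mem hxs hys, fun m hm => ?_⟩
    obtain ⟨k, hk⟩ := hx m hm
    obtain ⟨k', hk'⟩ := hy m hm
    refine ⟨k + k', ?_⟩
    rw [map_add, LinearMap.add_apply, hk, hk']
    push_cast
    ring
  smul_mem' := by
    rintro c x ⟨hxs, hx⟩
    refine ⟨?_, fun m hm => ?_⟩
    · rw [← Int.cast_smul_eq_zsmul ℚ c x]
      exact Submodule.smul_mem _ _ hxs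
    · obtain ⟨k, hk⟩ := hx m hm
      refine ⟨c * k, ?_⟩
      rw [← Int.cast_smul_eq_zsmul ℚ c x, map_smul, LinearMap.smul_apply, smul_eq_mul, hk]
      push_cast
      ring

/-- The discriminant group `D_M = M^∨ / M`. -/
abbrev discGroup {V : Type} [AddCommGroup V] [Module ℚ V]
    (Φ : V →ₗ[ℚ] V →ₗ[ℚ] ℚ) (M : Submodule ℤ V) : Type :=
  (dualLat Φ M) ⧸ (M.comap (dualLat Φ M).subtype)

/-- The class of `x ∈ M^∨` in the discriminant group `D_M`. -/
def discMk {V : Type} [AddCommGroup V] [Module ℚ V]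
    (Φ : V →ₗ[ℚ] V →ₗ[ℚ] ℚ) (M : Submodule ℤ V) (x : dualLat Φ M) : discGroup Φ M :=
  Submodule.Quotient.mk x

section

variable {V : Type} [AddCommGroup V] [Module ℚ V]

/-- An element of the rational span of a `ℤ`-submodule has a nonzero integral multiple in it. -/
lemma exists_zsmul_mem_of_mem_span (S : Submodule ℤ V) {v : V} (hv : v ∈ span ℚ (S : Set V)) :
    ∃ c : ℤ, c ≠ 0 ∧ c • v ∈ S := by
  induction hv using Submodule.span_induction with
  | mem x hx => exact ⟨1, one_ne_zero, by simpa using hx⟩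
  | zero => exact ⟨1, one_ne_zero, by simp⟩
  | add x y _ _ hx hy =>
    obtain ⟨a, ha, hax⟩ := hx
    obtain ⟨b, hb, hby⟩ := hy
    refine ⟨a * b, mul_ne_zero ha hb, ?_⟩
    have h : (a * b) • (x + y) = b • (a • x) + a • (b • y) := by module
    rw [h]
    exact S.add_mem (S.smul_mem _ hax) (S.smul_mem _ hby)
  | smul q x _ hx =>
    obtain ⟨a, ha, hax⟩ := hx
    refine ⟨a * q.den, mul_ne_zero ha (by exact_mod_cast q.den_nz), ?_⟩
    have h : (a * (q.den : ℤ)) • (q • x) = q.num • (a • x) := by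
      simp only [← Int.cast_smul_eq_zsmul ℚ, smul_smul]
      congr 1
      push_cast
      rw [mul_assoc, Rat.den_mul_eq_num, mul_comm]
    rw [h]
    exact S.smul_mem _ hax

/-- A functional is represented on any finite-dimensional subspace where the form is
nondegenerate. -/
lemma exists_mem_forall_apply_eq [FiniteDimensional ℚ V] (Φ : V →ₗ[ℚ] V →ₗ[ℚ] ℚ)
    (U : Submodule ℚ V) (hU : ∀ x ∈ U, (∀ y ∈ U, Φ x y = 0) → x = 0) (f : V →ₗ[ℚ] ℚ) :
    ∃ u ∈ U, ∀ w ∈ U, Φ u w = f w := by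
  have hinj : Function.Injective (Φ.domRestrict₁₂ U U) := by
    rw [injective_iff_map_eq_zero]
    intro x hx
    exact Subtype.ext (hU x x.2 fun y hy => DFunLike.congr_fun hx (⟨y, hy⟩ : U))
  have hsurj := (LinearMap.injective_iff_surjective_of_finrank_eq_finrank
    (Subspace.dual_finrank_eq (K := ℚ) (V := U)).symm).1 hinj
  obtain ⟨u, hu⟩ := hsurj (f.domRestrict U)
  exact ⟨u, u.2, fun w hw => DFunLike.congr_fun hu (⟨w, hw⟩ : U)⟩

/-- A linear map defined on a full lattice extends to the ambient rational vector space. -/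
lemma exists_linearMap_extending_lattice (L : Submodule ℤ V) (hfg : L.FG)
    (hspan : span ℚ (L : Set V) = ⊤) (r : L →ₗ[ℤ] V) :
    ∃ π : V →ₗ[ℚ] V, ∀ l : L, π l = r l := by
  have : Module.IsTorsionFree ℤ V := Module.IsTorsionFree.trans_faithfulSMul ℤ ℚ V
  have : Module.Finite ℤ L := Module.Finite.iff_fg.2 hfg
  let b := Module.Free.chooseBasis ℤ L
  have hli : LinearIndependent ℚ (fun i => (b i : V)) :=
    (LinearIndependent.iff_fractionRing ℤ ℚ).1
      (b.linearIndependent.map' L.subtype L.ker_subtype)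
  have hsp : ⊤ ≤ span ℚ (Set.range fun i => (b i : V)) := by
    rw [← hspan, span_le]
    intro x hx
    have h := congrArg L.subtype (b.sum_repr ⟨x, hx⟩)
    rw [map_sum] at h
    change _ = x at h
    rw [← h]
    refine sum_mem fun i _ => ?_
    rw [map_smul, ← Int.cast_smul_eq_zsmul ℚ]
    exact smul_mem _ _ (subset_span ⟨i, rfl⟩)
  let B := Module.Basis.mk hli hsp
  refine ⟨B.constr ℚ fun i => r (b i), fun l => ?_⟩
  have h : (B.constr ℚ fun i => r (b i)).restrictScalars ℤ ∘ₗ L.subtype = r := by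
    refine b.ext fun i => ?_
    have hB : (b i : V) = B i := (Module.Basis.mk_apply hli hsp i).symm
    simp only [LinearMap.comp_apply, subtype_apply, LinearMap.restrictScalars_apply]
    rw [hB, Module.Basis.constr_basis]
  exact DFunLike.congr_fun h l

/-- A saturated submodule of a finitely generated lattice is a retract. -/
lemma exists_retraction_of_saturated {E : Type*} [AddCommGroup E]
    (L P : Submodule ℤ E) (hfg : L.FG)
    (hsat : ∀ x ∈ L, ∀ c : ℤ, c ≠ 0 → c • x ∈ P → x ∈ P) :
    ∃ r : L →ₗ[ℤ] E, (∀ l, r l ∈ P) ∧ ∀ l : L, (l : E) ∈ P → r l = l := by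
  have : Module.Finite ℤ L := Module.Finite.iff_fg.2 hfg
  let P' := P.comap L.subtype
  have : Module.IsTorsionFree ℤ (L ⧸ P') := by
    refine Module.IsTorsionFree.of_smul_eq_zero fun c q hq => ?_
    obtain ⟨x, rfl⟩ := P'.mkQ_surjective q
    refine or_iff_not_imp_left.2 fun hc => ?_
    rw [← map_smul, mkQ_apply, Quotient.mk_eq_zero] at hq
    rw [mkQ_apply, Quotient.mk_eq_zero]
    exact hsat x x.2 c hc hq
  obtain ⟨s, hs⟩ := Module.projective_lifting_property P'.mkQ LinearMap.id P'.mkQ_surjective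
  refine ⟨L.subtype ∘ₗ (LinearMap.id - s ∘ₗ P'.mkQ), fun l => ?_, fun l hl => ?_⟩
  · have h : (LinearMap.id - s ∘ₗ P'.mkQ : L →ₗ[ℤ] L) l ∈ P' := by
      rw [← Quotient.mk_eq_zero P', ← mkQ_apply]
      have h2 := DFunLike.congr_fun hs (P'.mkQ l)
      simp only [LinearMap.comp_apply, LinearMap.id_apply] at h2
      simp only [LinearMap.sub_apply, LinearMap.comp_apply, LinearMap.id_apply, map_sub, h2,
        sub_self]
    exact h
  · have h : P'.mkQ l = 0 := (Quotient.mk_eq_zero P').2 hl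
    simp only [LinearMap.comp_apply, LinearMap.sub_apply, LinearMap.id_apply, h, map_zero,
      sub_zero, subtype_apply]

/-- In a unimodular lattice, a functional which is integral on a saturated submodule is
represented there by a lattice vector. -/
lemma exists_mem_lattice_forall_apply_eq [FiniteDimensional ℚ V] (Φ : V →ₗ[ℚ] V →ₗ[ℚ] ℚ)
    (hnd : ∀ x : V, (∀ y : V, Φ x y = 0) → x = 0)
    (L : Submodule ℤ V) (hfg : L.FG) (hspan : span ℚ (L : Set V) = ⊤)
    (hunimod : ∀ x : V, (∀ y ∈ L, ∃ k : ℤ, Φ x y = (k : ℚ)) → x ∈ L)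
    (P : Submodule ℤ V) (hPL : P ≤ L)
    (hsat : ∀ x ∈ L, ∀ c : ℤ, c ≠ 0 → c • x ∈ P → x ∈ P)
    (x : V) (hx : ∀ p ∈ P, ∃ k : ℤ, Φ x p = (k : ℚ)) :
    ∃ l ∈ L, ∀ p ∈ P, Φ l p = Φ x p := by
  obtain ⟨r, hrP, hr⟩ := exists_retraction_of_saturated L P hfg hsat
  obtain ⟨π, hπ⟩ := exists_linearMap_extending_lattice L hfg hspan r
  obtain ⟨l, -, hl⟩ := exists_mem_forall_apply_eq Φ ⊤
    (fun x _ h => hnd x fun y => h y mem_top) (Φ x ∘ₗ π)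
  refine ⟨l, hunimod l fun y hy => ?_, fun p hp => ?_⟩
  · rw [hl y mem_top, LinearMap.comp_apply, hπ ⟨y, hy⟩]
    exact hx _ (hrP _)
  · rw [hl p mem_top, LinearMap.comp_apply, hπ ⟨p, hPL hp⟩, hr ⟨p, hPL hp⟩ hp]

/-- A correspondence `R ≤ A × B` which is onto modulo `A₀` and `B₀`, and matches `A₀` with `B₀`,
induces an isomorphism of the quotients. -/
lemma exists_quotient_addEquiv_of_correspondence {A B : Type} [AddCommGroup A] [AddCommGroup B]
    (A₀ : Submodule ℤ A) (B₀ : Submodule ℤ B) (R : Submodule ℤ (A × B))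
    (hA : ∀ a, ∃ b, (a, b) ∈ R) (hB : ∀ b, ∃ a, (a, b) ∈ R)
    (hAB : ∀ a b, (a, b) ∈ R → (a ∈ A₀ ↔ b ∈ B₀)) :
    ∃ e : (A ⧸ A₀) ≃+ (B ⧸ B₀), ∀ a b, (a, b) ∈ R →
      e (Submodule.Quotient.mk a) = Submodule.Quotient.mk b := by
  let p : R →ₗ[ℤ] A ⧸ A₀ := A₀.mkQ ∘ₗ LinearMap.fst ℤ A B ∘ₗ R.subtype
  let q : R →ₗ[ℤ] B ⧸ B₀ := B₀.mkQ ∘ₗ LinearMap.snd ℤ A B ∘ₗ R.subtype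
  have hp : Function.Surjective p := by
    intro z
    obtain ⟨a, rfl⟩ := A₀.mkQ_surjective z
    obtain ⟨b, hb⟩ := hA a
    exact ⟨⟨(a, b), hb⟩, rfl⟩
  have hq : Function.Surjective q := by
    intro z
    obtain ⟨b, rfl⟩ := B₀.mkQ_surjective z
    obtain ⟨a, ha⟩ := hB b
    exact ⟨⟨(a, b), ha⟩, rfl⟩
  have hker : LinearMap.ker p = LinearMap.ker q := by
    ext ⟨⟨a, b⟩, h⟩
    rw [LinearMap.mem_ker, LinearMap.mem_ker]
    exact (Quotient.mk_eq_zero A₀).trans ((hAB a b h).trans (Quotient.mk_eq_zero B₀).symm)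
  let e := (p.quotKerEquivOfSurjective hp).symm ≪≫ₗ
    (Submodule.quotEquivOfEq _ _ hker ≪≫ₗ q.quotKerEquivOfSurjective hq)
  refine ⟨e.toAddEquiv, fun a b h => ?_⟩
  have h1 : (p.quotKerEquivOfSurjective hp).symm (Submodule.Quotient.mk a) =
      Submodule.Quotient.mk ⟨(a, b), h⟩ := by
    rw [LinearEquiv.symm_apply_eq]
    rfl
  change q.quotKerEquivOfSurjective hq (Submodule.quotEquivOfEq _ _ hker
    ((p.quotKerEquivOfSurjective hp).symm (Submodule.Quotient.mk a))) = _
  rw [h1]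
  rfl

end

/-- Nikulin: for an even unimodular lattice `L` (a full lattice in a
`ℚ`-vector space `V` with a nondegenerate symmetric bilinear form `Φ`, integral and even
on `L`, with `L^∨ = L`) and a primitive submodule `M ≤ L` on which the form is
nondegenerate, the form is also nondegenerate on `M^⊥`, and there is a group
isomorphism `λ : D_M ≃ D_{M^⊥}` such that (i) every `x ∈ M^∨` admits `y ∈ (M^⊥)^∨`
with `x + y ∈ L` and `λ[x] = [y]`, and (ii) `q_{M^⊥}(λ ξ) = −q_M(ξ)` in `ℚ/2ℤ`. -/
theorem stmt_0
    {V : Type} [AddCommGroup V] [Module ℚ V] [FiniteDimensional ℚ V]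
    (Φ : V →ₗ[ℚ] V →ₗ[ℚ] ℚ)
    (hsymm : ∀ x y : V, Φ x y = Φ y x)
    (hnd : ∀ x : V, (∀ y : V, Φ x y = 0) → x = 0)
    (L : Submodule ℤ V) (hfg : L.FG)
    (hspan : span ℚ (L : Set V) = ⊤)
    (heven : ∀ x ∈ L, ∃ k : ℤ, Φ x x = 2 * (k : ℚ))
    (hunimod : ∀ x : V, (∀ y ∈ L, ∃ k : ℤ, Φ x y = (k : ℚ)) ↔ x ∈ L)
    (M : Submodule ℤ V) (hML : M ≤ L)
    (hprim : ∀ x ∈ L, ∀ c : ℤ, c ≠ 0 → c • x ∈ M → x ∈ M)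
    (hMnd : ∀ x ∈ span ℚ (M : Set V),
      (∀ y ∈ span ℚ (M : Set V), Φ x y = 0) → x = 0) :
    (∀ x ∈ span ℚ ((perpLat Φ L M : Submodule ℤ V) : Set V),
      (∀ y ∈ span ℚ ((perpLat Φ L M : Submodule ℤ V) : Set V), Φ x y = 0) → x = 0) ∧
    ∃ e : discGroup Φ M ≃+ discGroup Φ (perpLat Φ L M),
      (∀ x : dualLat Φ M, ∃ y : dualLat Φ (perpLat Φ L M),
        (x : V) + (y : V) ∈ L ∧ e (discMk Φ M x) = discMk Φ (perpLat Φ L M) y) ∧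
      (∀ (x : dualLat Φ M) (y : dualLat Φ (perpLat Φ L M)),
        e (discMk Φ M x) = discMk Φ (perpLat Φ L M) y →
        ∃ k : ℤ, Φ (y : V) (y : V) = -Φ (x : V) (x : V) + 2 * (k : ℚ)) := by
  have zs : ∀ (c : ℤ) (x y : V), Φ (c • x) y = c * Φ x y := fun c x y => by
    rw [← Int.cast_smul_eq_zsmul ℚ c x, map_smul, LinearMap.smul_apply, smul_eq_mul]
  have hspan_ext : ∀ (S : Submodule ℤ V) (x : V), (∀ m ∈ S, Φ x m = 0) →
      ∀ w ∈ span ℚ (S : Set V), Φ x w = 0 := by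
    intro S x hx w hw
    have hle : span ℚ (S : Set V) ≤ LinearMap.ker (Φ x) := span_le.2 hx
    exact hle hw
  set N := perpLat Φ L M
  have hNL : N ≤ L := fun x hx => hx.1
  have hNspan : ∀ x : V, (∀ m ∈ M, Φ x m = 0) → x ∈ span ℚ (N : Set V) := by
    intro x hx
    obtain ⟨c, hc, hcx⟩ := exists_zsmul_mem_of_mem_span L (v := x) (hspan ▸ mem_top)
    have h : c • x ∈ N := ⟨hcx, fun m hm => by rw [zs, hx m hm, mul_zero]⟩
    have h2 : x = (c : ℚ)⁻¹ • (c • x) := by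
      rw [← Int.cast_smul_eq_zsmul ℚ c x, inv_smul_smul₀ (by exact_mod_cast hc)]
    rw [h2]
    exact smul_mem _ _ (subset_span h)
  have hNsat : ∀ x ∈ L, ∀ c : ℤ, c ≠ 0 → c • x ∈ N → x ∈ N := by
    refine fun x hx c hc hcx => ⟨hx, fun m hm => ?_⟩
    have h := hcx.2 m hm
    rw [zs] at h
    exact (mul_eq_zero.1 h).resolve_left (by exact_mod_cast hc)
  have horth : ∀ w ∈ span ℚ (M : Set V), ∀ z ∈ span ℚ (N : Set V), Φ w z = 0 := by
    intro w hw z hz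
    refine hspan_ext N w (fun n hn => ?_) z hz
    rw [hsymm]
    exact hspan_ext M n hn.2 w hw
  have hdecomp : ∀ v : V, ∃ w ∈ span ℚ (M : Set V), v - w ∈ span ℚ (N : Set V) := by
    intro v
    obtain ⟨w, hw, h⟩ := exists_mem_forall_apply_eq Φ _ hMnd (Φ v)
    refine ⟨w, hw, hNspan _ fun m hm => ?_⟩
    rw [map_sub, LinearMap.sub_apply, h m (subset_span hm), sub_self]
  have hNnd : ∀ x ∈ span ℚ (N : Set V), (∀ y ∈ span ℚ (N : Set V), Φ x y = 0) → x = 0 := by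
    refine fun x hx h => hnd x fun y => ?_
    obtain ⟨w, hw, hyw⟩ := hdecomp y
    rw [← add_sub_cancel w y, map_add, h _ hyw, hsymm, horth w hw x hx, add_zero]
  have hMspan : ∀ x : V, (∀ n ∈ N, Φ x n = 0) → x ∈ span ℚ (M : Set V) := by
    intro x hx
    obtain ⟨w, hw, hxw⟩ := hdecomp x
    have h : x - w = 0 := hNnd _ hxw fun y hy => by
      rw [map_sub, LinearMap.sub_apply, horth w hw y hy, hspan_ext N x hx y hy, sub_self]
    rwa [sub_eq_zero.1 h]
  have hL_int : ∀ l ∈ L, ∀ y ∈ L, ∃ k : ℤ, Φ l y = (k : ℚ) := fun l hl => (hunimod l).2 hl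
  have hunimod' := fun x => (hunimod x).1
  have hsat_span : ∀ S : Submodule ℤ V, (∀ x ∈ L, ∀ c : ℤ, c ≠ 0 → c • x ∈ S → x ∈ S) →
      ∀ x ∈ L, x ∈ span ℚ (S : Set V) → x ∈ S := by
    intro S hS x hx hxs
    obtain ⟨c, hc, h⟩ := exists_zsmul_mem_of_mem_span S hxs
    exact hS x hx c hc h
  let R : Submodule ℤ (dualLat Φ M × dualLat Φ N) :=
    L.comap (((dualLat Φ M).subtype).coprod (dualLat Φ N).subtype)
  have hR : ∀ x y, (x, y) ∈ R ↔ (x : V) + (y : V) ∈ L := fun x y => by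
    simp [R]
  have hA : ∀ x : dualLat Φ M, ∃ y : dualLat Φ N, (x, y) ∈ R := by
    intro x
    obtain ⟨l, hl, h⟩ := exists_mem_lattice_forall_apply_eq Φ hnd L hfg hspan hunimod' M hML
      hprim x x.2.2
    refine ⟨⟨l - x, hNspan _ fun m hm => ?_, fun n hn => ?_⟩, ?_⟩
    · rw [map_sub, LinearMap.sub_apply, h m hm, sub_self]
    · rw [map_sub, LinearMap.sub_apply, horth x x.2.1 n (subset_span hn), sub_zero]
      exact hL_int l hl n (hNL hn)
    · rw [hR, add_sub_cancel]
      exact hl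
  have hB : ∀ y : dualLat Φ N, ∃ x : dualLat Φ M, (x, y) ∈ R := by
    intro y
    obtain ⟨l, hl, h⟩ := exists_mem_lattice_forall_apply_eq Φ hnd L hfg hspan hunimod' N hNL
      hNsat y y.2.2
    refine ⟨⟨l - y, hMspan _ fun n hn => ?_, fun m hm => ?_⟩, ?_⟩
    · rw [map_sub, LinearMap.sub_apply, h n hn, sub_self]
    · rw [map_sub, LinearMap.sub_apply, hsymm y m, horth m (subset_span hm) y y.2.1, sub_zero]
      exact hL_int l hl m (hML hm)
    · rw [hR, sub_add_cancel]
      exact hl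
  obtain ⟨e, he⟩ := exists_quotient_addEquiv_of_correspondence
    (M.comap (dualLat Φ M).subtype) (N.comap (dualLat Φ N).subtype) R hA hB (by
      intro x y hxy
      rw [hR] at hxy
      refine ⟨fun hx => ?_, fun hy => ?_⟩
      · exact hsat_span N hNsat y ((L.add_mem_iff_right (hML hx)).1 hxy) y.2.1
      · exact hsat_span M hprim x ((L.add_mem_iff_left (hNL hy)).1 hxy) x.2.1)
  refine ⟨hNnd, e, fun x => ?_, fun x y hxy => ?_⟩
  · obtain ⟨y, hy⟩ := hA x
    exact ⟨y, (hR x y).1 hy, he x y hy⟩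
  · obtain ⟨z, hz⟩ := hA x
    have hyz : (y : V) - z ∈ N :=
      (Submodule.Quotient.eq (N.comap (dualLat Φ N).subtype)).1 (hxy.symm.trans (he x z hz))
    have hL : (x : V) + y ∈ L := by
      have h := L.add_mem ((hR x z).1 hz) (hNL hyz)
      rwa [add_add_sub_cancel] at h
    obtain ⟨k, hk⟩ := heven _ hL
    refine ⟨k, ?_⟩
    have h0 := horth x x.2.1 y y.2.1
    have h1 := hsymm y x
    simp only [map_add, LinearMap.add_apply] at hk
    linarith
end

section
/- Let L be an even unimodular lattice and M ⊆ L a primitive submodule on which the bilinear form is nondegenerate. Then the image of L under the orthogonal projection L ⊗ ℚ → M ⊗ ℚ is exactly M^∨; equivalently, for every x ∈ M^∨ there exists y ∈ (M^⊥) ⊗ ℚ such that x + y ∈ L. -/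
open Submodule

/-- A primitive submodule of a finitely generated module over `ℤ` is a direct summand: there is a
linear projection onto it. -/
theorem exists_projection_of_primitive {A : Type*} [AddCommGroup A] [Module.Finite ℤ A]
    (N : Submodule ℤ A) (hN : ∀ x : A, ∀ c : ℤ, c ≠ 0 → c • x ∈ N → x ∈ N) :
    ∃ p : A →ₗ[ℤ] A, (∀ x, p x ∈ N) ∧ ∀ x ∈ N, p x = x := by
  have : Module.IsTorsionFree ℤ (A ⧸ N) := by
    refine Module.IsTorsionFree.of_smul_eq_zero fun c q h => ?_
    obtain ⟨x, rfl⟩ := N.mkQ_surjective q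
    rw [← map_smul, mkQ_apply, Quotient.mk_eq_zero] at h
    rw [mkQ_apply, Quotient.mk_eq_zero]
    exact or_iff_not_imp_left.mpr fun hc => hN x c hc h
  obtain ⟨s, hs⟩ := Module.projective_lifting_property N.mkQ LinearMap.id N.mkQ_surjective
  refine ⟨LinearMap.id - s ∘ₗ N.mkQ, fun x => ?_, fun x hx => ?_⟩
  · have h := LinearMap.congr_fun hs (N.mkQ x)
    rw [LinearMap.comp_apply, LinearMap.id_apply] at h
    rw [← Quotient.mk_eq_zero, ← mkQ_apply]
    simp only [LinearMap.sub_apply, LinearMap.id_apply, LinearMap.comp_apply, map_sub, h, sub_self]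
  · have h : N.mkQ x = 0 := by rwa [mkQ_apply, Quotient.mk_eq_zero]
    simp only [LinearMap.sub_apply, LinearMap.id_apply, LinearMap.comp_apply, h, map_zero, sub_zero]

/-- A `ℤ`-linear functional on a full lattice of a finite-dimensional space is represented by a
vector with respect to any nondegenerate form. -/
theorem exists_vector_representing {V : Type*} [AddCommGroup V] [Module ℚ V]
    [FiniteDimensional ℚ V] (Φ : V →ₗ[ℚ] V →ₗ[ℚ] ℚ)
    (hnd : ∀ x : V, (∀ y : V, Φ x y = 0) → x = 0)
    (L : Submodule ℤ V) (hfg : L.FG) (hspan : span ℚ (L : Set V) = ⊤) (f : L →ₗ[ℤ] ℚ) :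
    ∃ z : V, ∀ l : L, Φ z l = f l := by
  have : IsLattice ℚ L := ⟨hfg, hspan⟩
  let b := Module.Free.chooseBasis ℤ L
  have hinj : Function.Injective Φ := by
    refine (injective_iff_map_eq_zero Φ).mpr fun x hx => hnd x fun y => ?_
    rw [hx, LinearMap.zero_apply]
  obtain ⟨z, hz⟩ := (LinearMap.injective_iff_surjective_of_finrank_eq_finrank
    (Subspace.dual_finrank_eq (K := ℚ) (V := V)).symm).mp hinj
    ((b.extendOfIsLattice ℚ).constr ℚ fun i => f (b i))
  refine ⟨z, fun l => ?_⟩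
  have h : (Φ z).restrictScalars ℤ ∘ₗ L.subtype = f := by
    refine b.ext fun i => ?_
    rw [LinearMap.comp_apply, LinearMap.restrictScalars_apply, hz, L.subtype_apply,
      ← b.extendOfIsLattice_apply ℚ i, Module.Basis.constr_basis]
  exact LinearMap.congr_fun h l

/-- Every element of the rational span of a `ℤ`-submodule has a nonzero integral multiple in the
submodule. -/
theorem exists_int_smul_mem_of_mem_span {V : Type*} [AddCommGroup V] [Module ℚ V]
    (L : Submodule ℤ V) {v : V} (hv : v ∈ span ℚ (L : Set V)) :
    ∃ c : ℤ, c ≠ 0 ∧ c • v ∈ L := by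
  induction hv using span_induction with
  | mem x hx => exact ⟨1, one_ne_zero, by rwa [one_smul]⟩
  | zero => exact ⟨1, one_ne_zero, by simp⟩
  | add x y _ _ hx hy =>
    obtain ⟨a, ha, hax⟩ := hx
    obtain ⟨b, hb, hby⟩ := hy
    refine ⟨a * b, mul_ne_zero ha hb, ?_⟩
    rw [smul_add, mul_smul a b y, mul_comm, mul_smul]
    exact add_mem (L.smul_mem b hax) (L.smul_mem a hby)
  | smul q x _ hx =>
    obtain ⟨a, ha, hax⟩ := hx
    refine ⟨q.den * a, mul_ne_zero (by exact_mod_cast q.den_nz) ha, ?_⟩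
    have h : ((q.den * a : ℤ)) • q • x = q.num • a • x := by
      simp only [← Int.cast_smul_eq_zsmul ℚ, smul_smul]
      congr 1
      push_cast
      rw [mul_right_comm, Rat.den_mul_eq_num]
    rw [h]
    exact L.smul_mem _ hax

/-- A vector orthogonal to `M` lies in the rational span of `perpLat Φ L M` when `L` spans. -/
theorem mem_span_perpLat {V : Type} [AddCommGroup V] [Module ℚ V]
    (Φ : V →ₗ[ℚ] V →ₗ[ℚ] ℚ) (L M : Submodule ℤ V) (hspan : span ℚ (L : Set V) = ⊤)
    {y : V} (hy : ∀ m ∈ M, Φ y m = 0) :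
    y ∈ span ℚ (perpLat Φ L M : Set V) := by
  obtain ⟨c, hc, hcy⟩ := exists_int_smul_mem_of_mem_span L (v := y) (hspan ▸ mem_top)
  rw [← Int.cast_smul_eq_zsmul ℚ] at hcy
  have h : (c : ℚ) • y ∈ span ℚ (perpLat Φ L M : Set V) :=
    subset_span ⟨hcy, fun m hm => by rw [map_smul, LinearMap.smul_apply, hy m hm, smul_zero]⟩
  exact (smul_mem_iff _ (by exact_mod_cast hc)).mp h

/-- Vectors in the rational span of `perpLat Φ L M` are orthogonal to `M`. -/
theorem apply_eq_zero_of_mem_span_perpLat {V : Type} [AddCommGroup V] [Module ℚ V]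
    (Φ : V →ₗ[ℚ] V →ₗ[ℚ] ℚ) (L M : Submodule ℤ V) {y : V}
    (hy : y ∈ span ℚ (perpLat Φ L M : Set V)) {m : V} (hm : m ∈ M) : Φ y m = 0 := by
  have h : span ℚ (perpLat Φ L M : Set V) ≤ LinearMap.ker (Φ.flip m) :=
    span_le.mpr fun x hx => hx.2 m hm
  exact h hy


/-- for an even unimodular lattice `L` and a primitive submodule `M ≤ L`
on which the form is nondegenerate, the image of `L` under the orthogonal projection
`L ⊗ ℚ → M ⊗ ℚ` is exactly the dual lattice `M^∨`: an element `x ∈ M ⊗ ℚ` lies in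
`M^∨` iff there is `y ∈ M^⊥ ⊗ ℚ` with `x + y ∈ L`. -/
theorem stmt_1
    {V : Type} [AddCommGroup V] [Module ℚ V] [FiniteDimensional ℚ V]
    (Φ : V →ₗ[ℚ] V →ₗ[ℚ] ℚ)
    (hsymm : ∀ x y : V, Φ x y = Φ y x)
    (hnd : ∀ x : V, (∀ y : V, Φ x y = 0) → x = 0)
    (L : Submodule ℤ V) (hfg : L.FG)
    (hspan : span ℚ (L : Set V) = ⊤)
    (heven : ∀ x ∈ L, ∃ k : ℤ, Φ x x = 2 * (k : ℚ))
    (hunimod : ∀ x : V, (∀ y ∈ L, ∃ k : ℤ, Φ x y = (k : ℚ)) ↔ x ∈ L)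
    (M : Submodule ℤ V) (hML : M ≤ L)
    (hprim : ∀ x ∈ L, ∀ c : ℤ, c ≠ 0 → c • x ∈ M → x ∈ M)
    (hMnd : ∀ x ∈ span ℚ (M : Set V),
      (∀ y ∈ span ℚ (M : Set V), Φ x y = 0) → x = 0) :
    ∀ x : V, x ∈ dualLat Φ M ↔
      (x ∈ span ℚ (M : Set V) ∧
        ∃ y ∈ span ℚ ((perpLat Φ L M : Submodule ℤ V) : Set V), x + y ∈ L) := by
  intro x
  constructor
  · rintro ⟨hx, hxM⟩
    refine ⟨hx, ?_⟩
    have : Module.Finite ℤ L := Module.Finite.iff_fg.mpr hfg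
    obtain ⟨p, hpM, hp⟩ := exists_projection_of_primitive (M.comap L.subtype)
      fun l c hc hl => hprim l l.2 c hc hl
    obtain ⟨z, hz⟩ := exists_vector_representing Φ hnd L hfg hspan
      ((Φ x).restrictScalars ℤ ∘ₗ L.subtype ∘ₗ p)
    have hzL : z ∈ L := by
      refine (hunimod z).mp fun l hl => ?_
      rw [hz ⟨l, hl⟩]
      exact hxM _ (hpM ⟨l, hl⟩)
    refine ⟨z - x, mem_span_perpLat Φ L M hspan fun m hm => ?_, by rwa [add_sub_cancel]⟩
    have h : Φ z m = Φ x (p ⟨m, hML hm⟩ : L) := hz ⟨m, hML hm⟩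
    rw [map_sub, LinearMap.sub_apply, h, hp ⟨m, hML hm⟩ hm, sub_self]
  · rintro ⟨hx, y, hy, hxy⟩
    refine ⟨hx, fun m hm => ?_⟩
    obtain ⟨k, hk⟩ := (hunimod (x + y)).mpr hxy m (hML hm)
    refine ⟨k, ?_⟩
    rw [← hk, map_add, LinearMap.add_apply, apply_eq_zero_of_mem_span_perpLat Φ L M hy hm,
      add_zero]
end

section
/- Fix a positive integer n. The set 2O' = {2A : A ∈ O'} is an additive subgroup of O of index 2, the set (1/2)(2O') = O' is closed under matrix multiplication, and 2O' is the unique additive subgroup L ⊆ O of index 2 with the property that A·B ∈ 2L for all A, B ∈ L (equivalently, (1/2)L = {A/2 : A ∈ L} is closed under multiplication). -/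
/-- The order `O ⊆ M₂(ℚ)`: matrices `[[a, 2b], [2nc, d]]` with `a, b, c, d ∈ ℤ`
and `a + d` even. -/
def memO (n : ℕ) (A : Matrix (Fin 2) (Fin 2) ℚ) : Prop :=
  ∃ a b c d : ℤ, Even (a + d) ∧
    A = !![(a : ℚ), 2 * (b : ℚ); 2 * (n : ℚ) * (c : ℚ), (d : ℚ)]

/-- The Eichler order `O' ⊆ M₂(ℚ)`: matrices `[[a, b], [nc, d]]` with `a, b, c, d ∈ ℤ`. -/
def memEichler (n : ℕ) (A : Matrix (Fin 2) (Fin 2) ℚ) : Prop :=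
  ∃ a b c d : ℤ, A = !![(a : ℚ), (b : ℚ); (n : ℚ) * (c : ℚ), (d : ℚ)]

/-- `L` is an additive subgroup of `S` of index `2`. -/
def IsIndexTwoAddSubgroupIn (L S : Set (Matrix (Fin 2) (Fin 2) ℚ)) : Prop :=
  L ⊆ S ∧ (0 : Matrix (Fin 2) (Fin 2) ℚ) ∈ L ∧
  (∀ x ∈ L, ∀ y ∈ L, x + y ∈ L) ∧ (∀ x ∈ L, -x ∈ L) ∧
  ∃ a ∈ S, a ∉ L ∧ ∀ x ∈ S, x ∈ L ∨ x - a ∈ L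

/-- `2S = {2A : A ∈ S}`. -/
def twoTimes (S : Set (Matrix (Fin 2) (Fin 2) ℚ)) : Set (Matrix (Fin 2) (Fin 2) ℚ) :=
  {X | ∃ Y ∈ S, X = (2 : ℚ) • Y}

theorem mem_twoTimes_eichler_iff {n : ℕ} {A : Matrix (Fin 2) (Fin 2) ℚ} :
    A ∈ twoTimes {A | memEichler n A} ↔ ∃ a b c d : ℤ,
      A = !![2 * (a : ℚ), 2 * (b : ℚ); 2 * (n : ℚ) * (c : ℚ), 2 * (d : ℚ)] := by
  constructor
  · rintro ⟨_, ⟨a, b, c, d, rfl⟩, rfl⟩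
    exact ⟨a, b, c, d, by simp [mul_assoc]⟩
  · rintro ⟨a, b, c, d, rfl⟩
    exact ⟨_, ⟨a, b, c, d, rfl⟩, by simp [mul_assoc]⟩

theorem memO_of_mem_twoTimes_eichler {n : ℕ} {A : Matrix (Fin 2) (Fin 2) ℚ}
    (hA : A ∈ twoTimes {A | memEichler n A}) : memO n A := by
  obtain ⟨a, b, c, d, rfl⟩ := mem_twoTimes_eichler_iff.1 hA
  exact ⟨2 * a, b, c, 2 * d, ⟨a + d, by ring⟩, by simp⟩

theorem memO_one (n : ℕ) : memO n 1 :=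
  ⟨1, 0, 0, 1, ⟨1, rfl⟩, by simp [Matrix.one_fin_two]⟩

theorem one_notMem_twoTimes_eichler (n : ℕ) : 1 ∉ twoTimes {A | memEichler n A} := by
  intro h
  obtain ⟨a, b, c, d, h⟩ := mem_twoTimes_eichler_iff.1 h
  have h00 : (1 : ℚ) = 2 * a := by simpa using congrFun₂ h 0 0
  norm_cast at h00
  omega

theorem twoTimes_eichler_add {n : ℕ} {A B : Matrix (Fin 2) (Fin 2) ℚ}
    (hA : A ∈ twoTimes {A | memEichler n A}) (hB : B ∈ twoTimes {A | memEichler n A}) :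
    A + B ∈ twoTimes {A | memEichler n A} := by
  rw [mem_twoTimes_eichler_iff] at *
  obtain ⟨a, b, c, d, rfl⟩ := hA
  obtain ⟨a', b', c', d', rfl⟩ := hB
  exact ⟨a + a', b + b', c + c', d + d', by simp [mul_add]⟩

theorem twoTimes_eichler_neg {n : ℕ} {A : Matrix (Fin 2) (Fin 2) ℚ}
    (hA : A ∈ twoTimes {A | memEichler n A}) : -A ∈ twoTimes {A | memEichler n A} := by
  rw [mem_twoTimes_eichler_iff] at *
  obtain ⟨a, b, c, d, rfl⟩ := hA
  exact ⟨-a, -b, -c, -d, by simp⟩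

theorem isIndexTwoAddSubgroupIn_twoTimes_eichler (n : ℕ) :
    IsIndexTwoAddSubgroupIn (twoTimes {A | memEichler n A}) {A | memO n A} := by
  refine ⟨fun _ => memO_of_mem_twoTimes_eichler, ?_, fun _ hx _ hy => twoTimes_eichler_add hx hy,
    fun _ => twoTimes_eichler_neg, 1, memO_one n, one_notMem_twoTimes_eichler n, ?_⟩
  · exact mem_twoTimes_eichler_iff.2 ⟨0, 0, 0, 0, by ext i j; fin_cases i <;> fin_cases j <;> simp⟩
  · rintro _ ⟨a, b, c, d, had, rfl⟩
    simp only [mem_twoTimes_eichler_iff]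
    rcases Int.even_or_odd' a with ⟨k, rfl | rfl⟩
    · obtain ⟨l, rfl⟩ : ∃ l, d = 2 * l := ⟨d / 2, by grind⟩
      exact Or.inl ⟨k, b, c, l, by simp⟩
    · obtain ⟨l, rfl⟩ : ∃ l, d = 2 * l + 1 := ⟨d / 2, by grind⟩
      exact Or.inr ⟨k, b, c, l, by simp [Matrix.one_fin_two]⟩

theorem memEichler_mul {n : ℕ} {A B : Matrix (Fin 2) (Fin 2) ℚ}
    (hA : memEichler n A) (hB : memEichler n B) : memEichler n (A * B) := by
  obtain ⟨a, b, c, d, rfl⟩ := hA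
  obtain ⟨a', b', c', d', rfl⟩ := hB
  refine ⟨a * a' + n * b * c', a * b' + b * d', c * a' + d * c', n * c * b' + d * d', ?_⟩
  rw [Matrix.mul_fin_two]
  push_cast
  congr! 3 <;> ring_nf

theorem mem_twoTimes_eichler_of_sq {n : ℕ} {A : Matrix (Fin 2) (Fin 2) ℚ} (hA : memO n A)
    (hsq : A * A ∈ twoTimes {A | memO n A}) : A ∈ twoTimes {A | memEichler n A} := by
  obtain ⟨a, b, c, d, had, rfl⟩ := hA
  obtain ⟨_, ⟨a', b', c', d', -, rfl⟩, h⟩ := hsq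
  have h00 : (a : ℚ) * a + 2 * b * (2 * n * c) = 2 * a' := by
    simpa [Matrix.mul_fin_two] using congrFun₂ h 0 0
  norm_cast at h00
  have ha : Even a := by
    have : Even (a * a) := ⟨a' - 2 * b * (n * c), by push_cast at h00; linarith⟩
    simpa [Int.even_mul] using this
  have hd : Even d := by grind
  obtain ⟨k, rfl⟩ := ha.two_dvd
  obtain ⟨l, rfl⟩ := hd.two_dvd
  exact mem_twoTimes_eichler_iff.2 ⟨k, b, c, l, by simp⟩

/-- An index-two subgroup contained in another index-two subgroup equals it. -/
theorem IsIndexTwoAddSubgroupIn.eq_of_subset {L M S : Set (Matrix (Fin 2) (Fin 2) ℚ)}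
    (hL : IsIndexTwoAddSubgroupIn L S) (hM : IsIndexTwoAddSubgroupIn M S) (hLM : L ⊆ M) :
    L = M := by
  obtain ⟨-, -, addL, negL, g, -, -, hg⟩ := hL
  obtain ⟨hMS, -, addM, negM, e, heS, heM, -⟩ := hM
  refine hLM.antisymm fun x hx => (hg x (hMS hx)).resolve_right fun hxg => ?_
  have heg : e - g ∈ L := (hg e heS).resolve_left fun h => heM (hLM h)
  refine heM ?_
  have h := addM _ (hLM (addL _ heg _ (negL _ hxg))) _ hx
  rwa [show e - g + -(x - g) + x = e by abel] at h

/-- `2O'` is an additive subgroup of `O` of index 2, `(1/2)(2O') = O'` is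
closed under matrix multiplication, and `2O'` is the unique additive subgroup `L ⊆ O` of
index 2 such that `A·B ∈ 2L` for all `A, B ∈ L`. -/
theorem stmt_5 (n : ℕ) (hn : 0 < n) :
    IsIndexTwoAddSubgroupIn (twoTimes {A | memEichler n A}) {A | memO n A} ∧
    {X | (2 : ℚ) • X ∈ twoTimes {A | memEichler n A}} = {A | memEichler n A} ∧
    (∀ A B : Matrix (Fin 2) (Fin 2) ℚ,
      memEichler n A → memEichler n B → memEichler n (A * B)) ∧
    (∀ L : Set (Matrix (Fin 2) (Fin 2) ℚ),
      IsIndexTwoAddSubgroupIn L {A | memO n A} →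
      (∀ A ∈ L, ∀ B ∈ L, A * B ∈ twoTimes L) →
      L = twoTimes {A | memEichler n A}) := by
  refine ⟨isIndexTwoAddSubgroupIn_twoTimes_eichler n, ?_, fun _ _ => memEichler_mul,
    fun L hL hmul => ?_⟩
  · ext X
    refine ⟨?_, fun hX => ⟨X, hX, rfl⟩⟩
    rintro ⟨Y, hY, h⟩
    rwa [smul_right_injective _ (two_ne_zero' ℚ) h]
  · refine hL.eq_of_subset (isIndexTwoAddSubgroupIn_twoTimes_eichler n) fun A hA => ?_
    obtain ⟨Y, hY, h⟩ := hmul A hA A hA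
    exact mem_twoTimes_eichler_of_sq (hL.1 hA) ⟨Y, hL.1 hY, h⟩
end

section
/- Fix a positive integer n. For every γ ∈ GL₂(ℚ), one has γ O γ⁻¹ = O if and only if γ O' γ⁻¹ = O'; that is, the normalizer of O in GL₂(ℚ) equals the normalizer of the Eichler order O'. -/
/-- `γ S γ⁻¹ = {γ A γ⁻¹ : A ∈ S}`. -/
def conjSet (γ : Matrix (Fin 2) (Fin 2) ℚ) (S : Set (Matrix (Fin 2) (Fin 2) ℚ)) :
    Set (Matrix (Fin 2) (Fin 2) ℚ) :=
  (fun A => γ * A * γ⁻¹) '' S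

theorem conjSet_eq_self_iff {γ : Matrix (Fin 2) (Fin 2) ℚ} (hγ : IsUnit γ.det)
    (S : Set (Matrix (Fin 2) (Fin 2) ℚ)) :
    conjSet γ S = S ↔ ∀ A, γ * A * γ⁻¹ ∈ S ↔ A ∈ S := by
  have hl (A : Matrix (Fin 2) (Fin 2) ℚ) : γ⁻¹ * (γ * A * γ⁻¹) * γ = A := by
    rw [Matrix.mul_assoc γ, Matrix.nonsing_inv_mul_cancel_left _ _ hγ,
      Matrix.nonsing_inv_mul_cancel_right _ _ hγ]
  have hr (A : Matrix (Fin 2) (Fin 2) ℚ) : γ * (γ⁻¹ * A * γ) * γ⁻¹ = A := by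
    rw [Matrix.mul_assoc γ⁻¹, Matrix.mul_nonsing_inv_cancel_left _ _ hγ,
      Matrix.mul_nonsing_inv_cancel_right _ _ hγ]
  constructor
  · refine fun h A => ⟨fun hA => ?_, fun hA => h ▸ ⟨A, hA, rfl⟩⟩
    rw [← h] at hA
    obtain ⟨B, hB, hBA⟩ := hA
    have hBA' := congrArg (fun X => γ⁻¹ * X * γ) hBA
    simp only [hl] at hBA'
    exact hBA' ▸ hB
  · refine fun h => Set.ext fun A => ⟨?_, fun hA => ⟨γ⁻¹ * A * γ, ?_, hr A⟩⟩
    · rintro ⟨B, hB, rfl⟩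
      exact (h B).2 hB
    · rw [← h, hr]
      exact hA

/-- `O = ℤ + 2O'`. -/
theorem memO_iff (n : ℕ) (A : Matrix (Fin 2) (Fin 2) ℚ) :
    memO n A ↔ ∃ z : ℤ, memEichler n ((1 / 2 : ℚ) • (A - (z : ℚ) • 1)) := by
  constructor
  · rintro ⟨a, b, c, d, ⟨k, hk⟩, rfl⟩
    refine ⟨d, k - d, b, c, 0, ?_⟩
    have hk' : (a : ℚ) + d = k + k := by exact_mod_cast hk
    ext i j
    fin_cases i <;> fin_cases j <;> simp
    · linarith
    · ring
  · rintro ⟨z, a, b, c, d, h⟩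
    refine ⟨z + 2 * a, b, c, z + 2 * d, ⟨z + a + d, by ring⟩, ?_⟩
    ext i j
    have hij := congrFun (congrFun h i) j
    fin_cases i <;> fin_cases j <;> simp at hij ⊢ <;> linarith

/-- `2O'` consists of the elements of `O` of even determinant. -/
theorem memEichler_iff (n : ℕ) (A : Matrix (Fin 2) (Fin 2) ℚ) :
    memEichler n A ↔
      memO n ((2 : ℚ) • A) ∧ ∃ k : ℤ, ((2 : ℚ) • A).det = 2 * (k : ℚ) := by
  constructor
  · rintro ⟨a, b, c, d, rfl⟩
    refine ⟨⟨2 * a, b, c, 2 * d, ⟨a + d, by ring⟩, ?_⟩, 2 * (a * d - b * (n * c)), ?_⟩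
    · ext i j
      fin_cases i <;> fin_cases j <;> simp
      ring
    · simp [Matrix.det_fin_two]
      ring
  · rintro ⟨⟨a, b, c, d, had, h⟩, k, hk⟩
    rw [h, Matrix.det_fin_two_of] at hk
    have hdet : a * d = 2 * (k + 2 * b * n * c) := by
      have : (a : ℚ) * d = 2 * (k + 2 * b * n * c) := by linarith
      exact_mod_cast this
    have hmul : Even (a * d) := hdet ▸ even_two_mul _
    rw [Int.even_add] at had
    rw [Int.even_mul, ← had, or_self] at hmul
    obtain ⟨x, rfl⟩ := hmul
    obtain ⟨y, rfl⟩ := had.1 ⟨x, rfl⟩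
    refine ⟨x, b, c, y, ?_⟩
    ext i j
    have hij := congrFun (congrFun h i) j
    fin_cases i <;> fin_cases j <;> simp at hij ⊢ <;> linarith

/-- for `γ ∈ GL₂(ℚ)`, `γ O γ⁻¹ = O` iff `γ O' γ⁻¹ = O'`:
the normalizer of `O` equals the normalizer of the Eichler order `O'`. -/
theorem stmt_6 (n : ℕ) (hn : 0 < n) (γ : Matrix (Fin 2) (Fin 2) ℚ)
    (hγ : IsUnit γ.det) :
    conjSet γ {A | memO n A} = {A | memO n A} ↔
      conjSet γ {A | memEichler n A} = {A | memEichler n A} := by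
  rw [conjSet_eq_self_iff hγ, conjSet_eq_self_iff hγ]
  simp only [Set.mem_ofPred_eq]
  constructor <;> intro h A
  · have hdet : ((2 : ℚ) • (γ * A * γ⁻¹)).det = ((2 : ℚ) • A).det := by
      rw [Matrix.det_smul, Matrix.det_smul,
        Matrix.det_conj ((Matrix.isUnit_iff_isUnit_det γ).2 hγ)]
    rw [memEichler_iff, memEichler_iff, hdet, ← h ((2 : ℚ) • A), Matrix.mul_smul,
      Matrix.smul_mul]
  · rw [memO_iff, memO_iff]
    refine exists_congr fun z => ?_
    rw [← h ((1 / 2 : ℚ) • (A - (z : ℚ) • 1))]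
    simp only [Matrix.mul_smul, Matrix.smul_mul, Matrix.mul_sub, Matrix.sub_mul,
      Matrix.mul_one, Matrix.mul_nonsing_inv _ hγ]
end

section
/- Fix a positive integer n. Let N and M be coprime positive integers with N·M = n, and let a, b ∈ ℤ satisfy aN − bM = 1. Put γ = [[aN, b],[n, N]] ∈ M₂(ℚ). Then det γ = N (so γ ∈ GL₂(ℚ)) and γ O' γ⁻¹ = O', i.e. the Atkin–Lehner matrix γ normalizes the Eichler order O'. -/
theorem conj_eq_of_mul_eq_mul {γ A B : Matrix (Fin 2) (Fin 2) ℚ} (hγ : IsUnit γ.det)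
    (h : γ * A = B * γ) : γ * A * γ⁻¹ = B := by
  rw [h, Matrix.mul_nonsing_inv_cancel_right _ _ hγ]

/-- for coprime positive `N, M` with `N·M = n` and `a, b ∈ ℤ` with
`aN − bM = 1`, the Atkin–Lehner matrix `γ = [[aN, b], [n, N]]` has `det γ = N` and
normalizes the Eichler order `O'`. -/
theorem stmt_7 (n N M : ℕ) (hn : 0 < n) (hN : 0 < N) (hM : 0 < M)
    (hcop : Nat.Coprime N M) (hNM : N * M = n) (a b : ℤ)
    (hab : a * (N : ℤ) - b * (M : ℤ) = 1) :
    (!![(a : ℚ) * (N : ℚ), (b : ℚ); (n : ℚ), (N : ℚ)]).det = (N : ℚ) ∧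
    conjSet !![(a : ℚ) * (N : ℚ), (b : ℚ); (n : ℚ), (N : ℚ)] {A | memEichler n A} =
      {A | memEichler n A} := by
  have h : (a : ℚ) * N - b * M = 1 := mod_cast hab
  have hdet : (!![(a : ℚ) * (N : ℚ), (b : ℚ); (n : ℚ), (N : ℚ)]).det = (N : ℚ) := by
    subst hNM
    rw [Matrix.det_fin_two_of]
    push_cast
    linear_combination (N : ℚ) * h
  have hunit : IsUnit (!![(a : ℚ) * (N : ℚ), (b : ℚ); (n : ℚ), (N : ℚ)]).det := by
    rw [hdet, isUnit_iff_ne_zero]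
    exact_mod_cast hN.ne'
  refine ⟨hdet, Set.Subset.antisymm ?_ ?_⟩
  · rintro _ ⟨_, ⟨p, q, r, s, rfl⟩, rfl⟩
    refine ⟨a * N * p + b * n * r - M * (a * N * q + b * s),
      -a * b * p - b ^ 2 * M * r + a ^ 2 * N * q + a * b * s,
      p + N * r - M * q - s, -b * (M * p + n * r) + a * (n * q + N * s),
      conj_eq_of_mul_eq_mul hunit ?_⟩
    subst hNM
    rw [Matrix.mul_fin_two, Matrix.mul_fin_two]
    push_cast
    simp only [EmbeddingLike.apply_eq_iff_eq, Matrix.vecCons_inj, and_true]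
    refine ⟨⟨?_, ?_⟩, ?_, ?_⟩
    · linear_combination -(a * N * p + b * (N * M * r)) * h
    · linear_combination -(a * N * q + b * s) * h
    · linear_combination -(N * M * p + N * (N * M * r)) * h
    · linear_combination -(N * M * q + N * s) * h
  · rintro _ ⟨p, q, r, s, rfl⟩
    refine ⟨_, ⟨(N * p - b * n * r) * a + (N * q - b * s) * M,
      b * p - b ^ 2 * M * r + N * q - b * s,
      -a * p + a ^ 2 * N * r - M * q + a * s,
      (-M * p + a * n * r) * b - n * q + a * N * s, rfl⟩, conj_eq_of_mul_eq_mul hunit ?_⟩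
    subst hNM
    rw [Matrix.mul_fin_two, Matrix.mul_fin_two]
    push_cast
    simp only [EmbeddingLike.apply_eq_iff_eq, Matrix.vecCons_inj, and_true]
    refine ⟨⟨?_, ?_⟩, ?_, ?_⟩
    · linear_combination (p * (a * N) + q * (N * M)) * h
    · linear_combination (p * b + q * N) * h
    · linear_combination (N * M * r * (a * N) + s * (N * M)) * h
    · linear_combination (N * M * r * b + s * N) * h
end

section
/- Let n > 1 be an integer. For every γ ∈ GL₂(ℚ) with γ O' γ⁻¹ = O', there exist coprime positive integers N, M with N·M = n, integers a, b with aN − bM = 1, a nonzero rational number q, and a matrix u ∈ O' with det u ∈ {1, −1}, such that γ = q · u · [[aN, b],[n, N]]. Moreover, the integer N is uniquely determined by γ (it does not depend on the choices of q, u, a, b). -/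
/-- The integers `x, y, z, w` have no common prime divisor. -/
def NoCommonPrime (x y z w : ℤ) : Prop :=
  ∀ p : ℤ, Prime p → p ∣ x → p ∣ y → p ∣ z → p ∣ w → False

lemma exists_noCommonPrime_smul (x y z w : ℤ) (h : ¬(x = 0 ∧ y = 0 ∧ z = 0 ∧ w = 0)) :
    ∃ g x' y' z' w' : ℤ, g ≠ 0 ∧ x = g * x' ∧ y = g * y' ∧ z = g * z' ∧ w = g * w' ∧
      NoCommonPrime x' y' z' w' := by
  set g : ℤ := gcd (gcd x y) (gcd z w) with hg
  obtain ⟨x', hx⟩ : g ∣ x := (gcd_dvd_left _ _).trans (gcd_dvd_left _ _)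
  obtain ⟨y', hy⟩ : g ∣ y := (gcd_dvd_left _ _).trans (gcd_dvd_right _ _)
  obtain ⟨z', hz⟩ : g ∣ z := (gcd_dvd_right _ _).trans (gcd_dvd_left _ _)
  obtain ⟨w', hw⟩ : g ∣ w := (gcd_dvd_right _ _).trans (gcd_dvd_right _ _)
  have hg0 : g ≠ 0 := by
    intro h0
    rw [h0, zero_mul] at hx hy hz hw
    exact h ⟨hx, hy, hz, hw⟩
  refine ⟨g, x', y', z', w', hg0, hx, hy, hz, hw, fun p hp h1 h2 h3 h4 => ?_⟩
  have key : g * p ∣ g * 1 := by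
    rw [mul_one]
    refine dvd_gcd (dvd_gcd ?_ ?_) (dvd_gcd ?_ ?_)
    · rw [hx]; exact mul_dvd_mul_left g h1
    · rw [hy]; exact mul_dvd_mul_left g h2
    · rw [hz]; exact mul_dvd_mul_left g h3
    · rw [hw]; exact mul_dvd_mul_left g h4
  exact hp.not_isUnit (isUnit_of_dvd_one ((mul_dvd_mul_iff_left hg0).1 key))

lemma exists_noCommonPrime_rat (x y z w : ℚ) (h : ¬(x = 0 ∧ y = 0 ∧ z = 0 ∧ w = 0)) :
    ∃ (q : ℚ) (x' y' z' w' : ℤ), q ≠ 0 ∧ x = q * x' ∧ y = q * y' ∧ z = q * z' ∧ w = q * w' ∧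
      NoCommonPrime x' y' z' w' := by
  obtain ⟨⟨b, hb⟩, hb'⟩ :=
    IsLocalization.exist_integer_multiples_of_finset (nonZeroDivisors ℤ) ({x, y, z, w} : Finset ℚ)
  have hb0 : (b : ℚ) ≠ 0 := by exact_mod_cast nonZeroDivisors.ne_zero hb
  have clear : ∀ a ∈ ({x, y, z, w} : Finset ℚ), ∃ m : ℤ, a = (b : ℚ)⁻¹ * m := by
    intro a ha
    obtain ⟨m, hm⟩ := hb' a ha
    refine ⟨m, ?_⟩
    simp only [algebraMap_int_eq, eq_intCast, zsmul_eq_mul] at hm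
    rw [hm]
    field_simp
  obtain ⟨X, hX⟩ := clear x (by simp)
  obtain ⟨Y, hY⟩ := clear y (by simp)
  obtain ⟨Z, hZ⟩ := clear z (by simp)
  obtain ⟨W, hW⟩ := clear w (by simp)
  obtain ⟨g, x', y', z', w', hg, rfl, rfl, rfl, rfl, hp⟩ := exists_noCommonPrime_smul X Y Z W (by
    rintro ⟨rfl, rfl, rfl, rfl⟩
    exact h (by simp [hX, hY, hZ, hW]))
  refine ⟨(b : ℚ)⁻¹ * g, x', y', z', w', ?_, ?_, ?_, ?_, ?_, hp⟩
  · have : (g : ℚ) ≠ 0 := by exact_mod_cast hg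
    positivity
  all_goals simp only [hX, hY, hZ, hW]; push_cast; ring

lemma isCoprime_det_of_dvd {D x y z w n : ℤ} (hD0 : D ≠ 0) (hD : D = x * w - n * y * z)
    (hprim : NoCommonPrime x y z w) (hx : D ∣ x ^ 2) (hw : D ∣ w ^ 2) (hzw : D ∣ z * w)
    (hnz : D ∣ n * z ^ 2) : IsCoprime D y := by
  refine isCoprime_of_prime_dvd (fun h => hD0 h.1) fun p hp hpD hpy => ?_
  have hpx : p ∣ x := hp.dvd_of_dvd_pow (hpD.trans hx)
  have hpw : p ∣ w := hp.dvd_of_dvd_pow (hpD.trans hw)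
  have hpz : ¬p ∣ z := fun h => hprim p hp hpx hpy h hpw
  have hfin := FiniteMultiplicity.of_prime_left hp hD0
  set k := multiplicity p D
  have hkD : p ^ k ∣ D := pow_multiplicity_dvd p D
  have hDk : ¬p ^ (k + 1) ∣ D := hfin.not_pow_dvd_of_multiplicity_lt (Nat.lt_succ_self _)
  have hcop : IsCoprime (p ^ k) z := (hp.irreducible.coprime_iff_not_dvd.2 hpz).pow_left
  obtain ⟨w', hw'⟩ : p ^ k ∣ w := hcop.dvd_of_dvd_mul_left (hkD.trans hzw)
  obtain ⟨n', hn'⟩ : p ^ k ∣ n := hcop.pow_right.dvd_of_dvd_mul_right (hkD.trans hnz)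
  obtain ⟨x', hx'⟩ := hpx
  obtain ⟨y', hy'⟩ := hpy
  refine hDk ⟨x' * w' - n' * y' * z, ?_⟩
  rw [hD, hw', hn', hx', hy']
  ring

/-- Integral form of the statement that conjugation by `!![x, y; n * z, w]` maps the
Eichler order into itself. -/
lemma exists_conj_eq {n : ℕ} {γ : Matrix (Fin 2) (Fin 2) ℚ} (hγ : IsUnit γ.det)
    (hnorm : conjSet γ {A | memEichler n A} = {A | memEichler n A}) {q : ℚ} (hq : q ≠ 0)
    {x y z w : ℤ} (hγq : γ = q • !![(x : ℚ), (y : ℚ); (n : ℚ) * z, (w : ℚ)]) (a b c d : ℤ) :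
    ∃ a' b' c' d' : ℤ, !![x, y; n * z, w] * !![a, b; n * c, d] =
      !![a', b'; n * c', d'] * !![x, y; n * z, w] := by
  have hmem : γ * !![(a : ℚ), (b : ℚ); (n : ℚ) * c, (d : ℚ)] * γ⁻¹ ∈ {A | memEichler n A} := by
    rw [← hnorm]
    exact ⟨_, ⟨a, b, c, d, rfl⟩, rfl⟩
  obtain ⟨a', b', c', d', h⟩ := hmem
  refine ⟨a', b', c', d', ?_⟩
  have h2 := congrArg (· * γ) h
  simp only [Matrix.nonsing_inv_mul_cancel_right _ _ hγ] at h2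
  rw [hγq, Matrix.smul_mul, Matrix.mul_smul] at h2
  have h3 := smul_right_injective _ hq h2
  have hinj : Function.Injective (fun A : Matrix (Fin 2) (Fin 2) ℤ => A.map (Int.castRingHom ℚ)) :=
    Matrix.map_injective (RingHom.injective_int _)
  apply hinj
  simp only [Matrix.map_mul]
  convert h3 using 2 <;> (ext i j; fin_cases i <;> fin_cases j <;> simp)

lemma dvd_of_conj_eq {n x y z w a b c d a' b' c' d' : ℤ}
    (h : !![x, y; n * z, w] * !![a, b; n * c, d] = !![a', b'; n * c', d'] * !![x, y; n * z, w]) :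
    (x * w - n * y * z) * b' = -(x * a + y * (n * c)) * y + (x * b + y * d) * x ∧
    (x * w - n * y * z) * (n * c') =
      (n * z * a + w * (n * c)) * w - (n * z * b + w * d) * (n * z) := by
  have h00 := congrFun (congrFun h 0) 0
  have h01 := congrFun (congrFun h 0) 1
  have h10 := congrFun (congrFun h 1) 0
  have h11 := congrFun (congrFun h 1) 1
  simp [Matrix.mul_apply, Fin.sum_univ_two] at h00 h01 h10 h11
  constructor
  · linear_combination y * h00 - x * h01
  · linear_combination -w * h10 + n * z * h11

/-- A matrix normalizing the Eichler order is, up to a scalar, of Atkin–Lehner shape. -/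
lemma exists_atkinLehner_shape {n : ℕ} (hn : n ≠ 0) {γ : Matrix (Fin 2) (Fin 2) ℚ}
    (hγ : IsUnit γ.det) (hnorm : conjSet γ {A | memEichler n A} = {A | memEichler n A}) :
    ∃ (q : ℚ) (D m x y z w : ℤ), q ≠ 0 ∧ D ≠ 0 ∧ (n : ℤ) = D * m ∧ D * x * w - m * y * z = 1 ∧
      γ = q • !![((D * x : ℤ) : ℚ), (y : ℚ); (n : ℚ) * z, ((D * w : ℤ) : ℚ)] := by
  have hnQ : (n : ℚ) ≠ 0 := by exact_mod_cast hn
  have hnZ : (n : ℤ) ≠ 0 := by exact_mod_cast hn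
  have hdet : γ 0 0 * γ 1 1 - γ 0 1 * γ 1 0 ≠ 0 := by
    rw [← Matrix.det_fin_two]
    exact hγ.ne_zero
  obtain ⟨q, x, y, z, w, hq, hx, hy, hz, hw, hprim⟩ :=
    exists_noCommonPrime_rat (γ 0 0) (γ 0 1) (γ 1 0 / n) (γ 1 1) (by
      rintro ⟨h1, h2, -, -⟩
      simp [h1, h2] at hdet)
  have hz' : γ 1 0 = q * (n * z) := by
    field_simp at hz
    rw [hz]
    ring
  have hγq : γ = q • !![(x : ℚ), (y : ℚ); (n : ℚ) * z, (w : ℚ)] := by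
    ext i j
    fin_cases i <;> fin_cases j <;> simp [hx, hy, hz', hw]
  obtain ⟨D, hD⟩ : ∃ D : ℤ, D = x * w - n * y * z := ⟨_, rfl⟩
  have hD0 : D ≠ 0 := by
    intro h0
    apply hdet
    rw [h0] at hD
    have hDq : (0 : ℚ) = x * w - n * y * z := by exact_mod_cast hD
    rw [hx, hy, hz', hw]
    linear_combination -q ^ 2 * hDq
  have conj := fun a b c d => exists_conj_eq hγ hnorm hq hγq a b c d
  obtain ⟨hxy, hzw⟩ : D ∣ x * y ∧ D ∣ z * w := by
    obtain ⟨a, b, c, d, h⟩ := conj 1 0 0 0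
    obtain ⟨h1, h2⟩ := dvd_of_conj_eq h
    rw [← hD] at h1 h2
    exact ⟨⟨-b, by linear_combination h1⟩,
      ⟨c, mul_left_cancel₀ hnZ (by linear_combination -h2)⟩⟩
  obtain ⟨hxx, hzz⟩ : D ∣ x ^ 2 ∧ D ∣ n * z ^ 2 := by
    obtain ⟨a, b, c, d, h⟩ := conj 0 1 0 0
    obtain ⟨h1, h2⟩ := dvd_of_conj_eq h
    rw [← hD] at h1 h2
    exact ⟨⟨b, by linear_combination -h1⟩,
      ⟨-c, mul_left_cancel₀ hnZ (by linear_combination h2)⟩⟩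
  obtain ⟨hyy, hww⟩ : D ∣ n * y ^ 2 ∧ D ∣ w ^ 2 := by
    obtain ⟨a, b, c, d, h⟩ := conj 0 0 1 0
    obtain ⟨h1, h2⟩ := dvd_of_conj_eq h
    rw [← hD] at h1 h2
    exact ⟨⟨-b, by linear_combination h1⟩,
      ⟨c, mul_left_cancel₀ hnZ (by linear_combination -h2)⟩⟩
  have hcy : IsCoprime D y := isCoprime_det_of_dvd hD0 hD hprim hxx hww hzw hzz
  have hcz : IsCoprime D z := isCoprime_det_of_dvd (x := w) (w := x) (z := y) (n := n) hD0
    (by rw [hD]; ring) (fun p hp h1 h2 h3 h4 => hprim p hp h4 h3 h2 h1) hww hxx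
    (by rwa [mul_comm]) hyy
  obtain ⟨x', rfl⟩ := hcy.dvd_of_dvd_mul_right hxy
  obtain ⟨w', rfl⟩ := hcz.dvd_of_dvd_mul_left hzw
  obtain ⟨m, hm⟩ := hcz.pow_right.dvd_of_dvd_mul_right hzz
  refine ⟨q, D, m, x', y, z, w', hq, hD0, hm, mul_left_cancel₀ hD0 ?_, hγq⟩
  rw [hm] at hD
  linear_combination -hD

/-- The first column `(x, n * z)` of a unit of the Eichler order times an Atkin–Lehner matrix has
`x` and `z` coprime. -/
lemma exists_isCoprime_column {n N : ℕ} {a b : ℤ} {u : Matrix (Fin 2) (Fin 2) ℚ}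
    (hu : memEichler n u) (hdet : u.det = 1 ∨ u.det = -1) :
    ∃ x z : ℤ, IsCoprime x z ∧
      (u * !![(a : ℚ) * (N : ℚ), (b : ℚ); (n : ℚ), (N : ℚ)]) 0 0 = x ∧
      (u * !![(a : ℚ) * (N : ℚ), (b : ℚ); (n : ℚ), (N : ℚ)]) 1 0 = n * z := by
  obtain ⟨e, f, g, h, rfl⟩ := hu
  refine ⟨e * (a * N) + f * n, g * (a * N) + h, ?_, ?_, ?_⟩
  · have hdet' : e * h - f * (n * g) = 1 ∨ e * h - f * (n * g) = -1 := by
      rw [Matrix.det_fin_two_of] at hdet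
      exact_mod_cast hdet
    rcases hdet' with hd | hd
    · exact ⟨-g, e, by linear_combination hd⟩
    · exact ⟨g, -e, by linear_combination -hd⟩
  · simp [Matrix.mul_apply, Fin.sum_univ_two]
  · simp [Matrix.mul_apply, Fin.sum_univ_two]
    ring

lemma exists_eq_mul_int_of_isCoprime {q r : ℚ} {x z X Z : ℤ} (h : IsCoprime x z)
    (hx : q * x = r * X) (hz : q * z = r * Z) : ∃ k : ℤ, q = r * k := by
  obtain ⟨s, t, hst⟩ := h
  have hst' : (s : ℚ) * x + t * z = 1 := by exact_mod_cast hst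
  refine ⟨s * X + t * Z, ?_⟩
  push_cast
  linear_combination (s : ℚ) * hx + t * hz - q * hst'

lemma sq_eq_sq_of_isCoprime {q r : ℚ} (hq : q ≠ 0) {x z X Z : ℤ} (h : IsCoprime x z)
    (H : IsCoprime X Z) (hx : q * x = r * X) (hz : q * z = r * Z) : q ^ 2 = r ^ 2 := by
  obtain ⟨k, hk⟩ := exists_eq_mul_int_of_isCoprime h hx hz
  obtain ⟨l, hl⟩ := exists_eq_mul_int_of_isCoprime H hx.symm hz.symm
  have hlk : l * k = 1 := by
    have : (l : ℚ) * k = 1 := mul_left_cancel₀ hq (by rw [← mul_assoc, ← hl, ← hk, mul_one])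
    exact_mod_cast this
  rcases Int.eq_one_or_neg_one_of_mul_eq_one' hlk with ⟨-, rfl⟩ | ⟨-, rfl⟩ <;> simp [hk]

lemma abs_det_smul_mul_atkinLehner {n N M : ℕ} (hNM : N * M = n) {a b : ℤ}
    (hab : a * (N : ℤ) - b * (M : ℤ) = 1) (q : ℚ) {u : Matrix (Fin 2) (Fin 2) ℚ}
    (hdet : u.det = 1 ∨ u.det = -1) :
    |(q • (u * !![(a : ℚ) * (N : ℚ), (b : ℚ); (n : ℚ), (N : ℚ)])).det| = q ^ 2 * N := by
  have hW : (!![(a : ℚ) * (N : ℚ), (b : ℚ); (n : ℚ), (N : ℚ)]).det = N := by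
    have hab' : (a : ℚ) * N - b * M = 1 := by exact_mod_cast hab
    rw [Matrix.det_fin_two_of, ← hNM]
    push_cast
    linear_combination (N : ℚ) * hab'
  have hu : |u.det| = 1 := by rcases hdet with h | h <;> simp [h]
  rw [Matrix.det_smul, Matrix.det_mul, hW, abs_mul, abs_mul, hu]
  simp

/-- `γ` is a scalar times a unit of the Eichler order times an Atkin–Lehner matrix of
determinant `N`. -/
def IsAtkinLehnerProduct (n : ℕ) (γ : Matrix (Fin 2) (Fin 2) ℚ) (N : ℕ) : Prop :=
  ∃ M : ℕ, 0 < N ∧ 0 < M ∧ Nat.Coprime N M ∧ N * M = n ∧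
    ∃ a b : ℤ, a * (N : ℤ) - b * (M : ℤ) = 1 ∧
      ∃ q : ℚ, q ≠ 0 ∧
        ∃ u : Matrix (Fin 2) (Fin 2) ℚ, memEichler n u ∧
          (u.det = 1 ∨ u.det = -1) ∧
          γ = q • (u * !![(a : ℚ) * (N : ℚ), (b : ℚ); (n : ℚ), (N : ℚ)])

lemma IsAtkinLehnerProduct.unique {n : ℕ} (hn : n ≠ 0) {γ : Matrix (Fin 2) (Fin 2) ℚ} {N N' : ℕ}
    (h : IsAtkinLehnerProduct n γ N) (h' : IsAtkinLehnerProduct n γ N') : N = N' := by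
  obtain ⟨M, -, -, -, hNM, a, b, hab, q, hq, u, hu, hdet, hγ⟩ := h
  obtain ⟨M', -, -, -, hNM', a', b', hab', r, -, u', hu', hdet', hγ'⟩ := h'
  have hnQ : (n : ℚ) ≠ 0 := by exact_mod_cast hn
  obtain ⟨x, z, hxz, hx, hz⟩ := exists_isCoprime_column (N := N) (a := a) (b := b) hu hdet
  obtain ⟨X, Z, hXZ, hX, hZ⟩ := exists_isCoprime_column (N := N') (a := a') (b := b') hu' hdet'
  have h00 := congrFun (congrFun (hγ.symm.trans hγ') 0) 0
  have h10 := congrFun (congrFun (hγ.symm.trans hγ') 1) 0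
  rw [Matrix.smul_apply, Matrix.smul_apply, smul_eq_mul, smul_eq_mul, hx, hX] at h00
  rw [Matrix.smul_apply, Matrix.smul_apply, smul_eq_mul, smul_eq_mul, hz, hZ] at h10
  have hsq : q ^ 2 = r ^ 2 := sq_eq_sq_of_isCoprime hq hxz hXZ h00
    (mul_left_cancel₀ hnQ (by linear_combination h10))
  have hd := abs_det_smul_mul_atkinLehner hNM hab q hdet
  rw [← hγ, hγ', abs_det_smul_mul_atkinLehner hNM' hab' r hdet', ← hsq] at hd
  exact_mod_cast (mul_left_cancel₀ (pow_ne_zero 2 hq) hd).symm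

lemma exists_isAtkinLehnerProduct {n : ℕ} (hn0 : n ≠ 0) {γ : Matrix (Fin 2) (Fin 2) ℚ}
    (hγ : IsUnit γ.det) (hnorm : conjSet γ {A | memEichler n A} = {A | memEichler n A}) :
    ∃ N, IsAtkinLehnerProduct n γ N := by
  obtain ⟨q, D, m, x, y, z, w, hq, hD0, hnD, hrel, hγq⟩ := exists_atkinLehner_shape hn0 hγ hnorm
  obtain ⟨ε, hε, hDN⟩ : ∃ ε : ℤ, (ε = 1 ∨ ε = -1) ∧ D = ε * D.natAbs := by
    rcases Int.natAbs_eq D with h | h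
    · exact ⟨1, Or.inl rfl, by rwa [one_mul]⟩
    · exact ⟨-1, Or.inr rfl, by rwa [neg_one_mul]⟩
  have hε2 : ε * ε = 1 := by rcases hε with rfl | rfl <;> rfl
  obtain ⟨N, hN⟩ : ∃ N : ℕ, N = D.natAbs := ⟨_, rfl⟩
  rw [← hN] at hDN
  have hN0 : N ≠ 0 := by rw [hN]; exact Int.natAbs_ne_zero.2 hD0
  obtain ⟨M, rfl⟩ : N ∣ n := by
    rw [hN, ← Int.natCast_dvd_natCast, Int.natAbs_dvd]
    exact ⟨m, hnD⟩
  have hM0 : M ≠ 0 := right_ne_zero_of_mul hn0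
  have hNZ : (N : ℤ) ≠ 0 := by exact_mod_cast hN0
  have hM : (M : ℤ) = ε * m := mul_left_cancel₀ hNZ (by
    push_cast at hnD
    linear_combination hnD + m * hDN)
  have hrel' : (N : ℤ) * (x * w) - M * (y * z) = ε := by
    rw [hM]
    linear_combination ε * hrel - ε * x * w * hDN - N * x * w * hε2
  have hcop : IsCoprime (N : ℤ) M :=
    ⟨ε * (x * w), -(ε * (y * z)), by linear_combination ε * hrel' + hε2⟩
  refine ⟨N, ⟨M, Nat.pos_of_ne_zero hN0, Nat.pos_of_ne_zero hM0,
    Nat.isCoprime_iff_coprime.1 hcop, rfl, ?_⟩⟩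
  obtain ⟨a, b, hab⟩ := hcop
  refine ⟨a, -b, by linear_combination hab, q, hq,
    !![((N * (ε * x) - M * y : ℤ) : ℚ), ((a * y + b * (ε * x) : ℤ) : ℚ);
      ((N * M : ℕ) : ℚ) * ((z - ε * w : ℤ) : ℚ), ((M * z * b + a * N * (ε * w) : ℤ) : ℚ)],
    ⟨_, _, _, _, rfl⟩, ?_, ?_⟩
  · rw [Matrix.det_fin_two_of]
    have hdet : (N * (ε * x) - M * y) * (M * z * b + a * N * (ε * w)) -
        (a * y + b * (ε * x)) * (N * M * (z - ε * w)) = ε := by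
      linear_combination ε * hab + (a * N + b * M) * (hrel' + N * x * w * hε2)
    have hdetQ : ((N : ℚ) * (ε * x) - M * y) * (M * z * b + a * N * (ε * w)) -
        (a * y + b * (ε * x)) * (N * M * (z - ε * w)) = ε := by exact_mod_cast hdet
    push_cast
    rw [hdetQ]
    exact_mod_cast hε
  · have hab' : (a : ℚ) * N + b * M = 1 := by exact_mod_cast hab
    have hDQ : (D : ℚ) = ε * N := by exact_mod_cast hDN
    rw [hγq]
    congr 1
    ext i j
    fin_cases i <;> fin_cases j <;> simp [Matrix.mul_apply, Fin.sum_univ_two, hDQ]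
    · linear_combination (-(ε * N * x : ℚ)) * hab'
    · linear_combination (-y : ℚ) * hab'
    · linear_combination (-(N * M * z : ℚ)) * hab'
    · linear_combination (-(ε * N * w : ℚ)) * hab'

/-- for `n > 1`, every `γ ∈ GL₂(ℚ)` normalizing the Eichler order `O'`
can be written as `γ = q · u · [[aN, b], [n, N]]` with `N·M = n`, `gcd(N, M) = 1`,
`aN − bM = 1`, `q ∈ ℚ^×` and `u` a unit of `O'`; moreover `N` is uniquely
determined by `γ`. -/
theorem stmt_8 (n : ℕ) (hn : 1 < n) (γ : Matrix (Fin 2) (Fin 2) ℚ)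
    (hγ : IsUnit γ.det)
    (hnorm : conjSet γ {A | memEichler n A} = {A | memEichler n A}) :
    ∃! N : ℕ, ∃ M : ℕ, 0 < N ∧ 0 < M ∧ Nat.Coprime N M ∧ N * M = n ∧
      ∃ a b : ℤ, a * (N : ℤ) - b * (M : ℤ) = 1 ∧
        ∃ q : ℚ, q ≠ 0 ∧
          ∃ u : Matrix (Fin 2) (Fin 2) ℚ, memEichler n u ∧
            (u.det = 1 ∨ u.det = -1) ∧
            γ = q • (u * !![(a : ℚ) * (N : ℚ), (b : ℚ); (n : ℚ), (N : ℚ)]) := by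
  have hn0 : n ≠ 0 := by omega
  obtain ⟨N, hN⟩ := exists_isAtkinLehnerProduct hn0 hγ hnorm
  exact ⟨N, hN, fun _ hN' => IsAtkinLehnerProduct.unique hn0 hN' hN⟩
end

section
/- A matrix γ ∈ GL₂(ℚ) satisfies γ M₂(ℤ) γ⁻¹ = M₂(ℤ) if and only if there exist a nonzero rational number q and an integer matrix u with det u ∈ {1, −1} such that γ = q·u; that is, the normalizer of M₂(ℤ) in GL₂(ℚ) equals ℚ^× · GL₂(ℤ). -/
/-- A rational matrix with integer entries. -/
def isIntMat (A : Matrix (Fin 2) (Fin 2) ℚ) : Prop :=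
  ∀ i j, ∃ k : ℤ, A i j = (k : ℚ)

theorem isIntMat.mul {A B : Matrix (Fin 2) (Fin 2) ℚ} (hA : isIntMat A) (hB : isIntMat B) :
    isIntMat (A * B) := by
  intro i j
  choose a ha using hA
  choose b hb using hB
  exact ⟨∑ k, a i k * b k j, by simp [Matrix.mul_apply, ha, hb]⟩

theorem isIntMat.adjugate {A : Matrix (Fin 2) (Fin 2) ℚ} (hA : isIntMat A) :
    isIntMat A.adjugate := by
  choose a ha using hA
  intro i j
  rw [Matrix.adjugate_fin_two]
  fin_cases i <;> fin_cases j
  · exact ⟨a 1 1, by simp [ha]⟩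
  · exact ⟨-a 0 1, by simp [ha]⟩
  · exact ⟨-a 1 0, by simp [ha]⟩
  · exact ⟨a 0 0, by simp [ha]⟩

theorem isIntMat.inv {A : Matrix (Fin 2) (Fin 2) ℚ} (hA : isIntMat A)
    (hdet : A.det = 1 ∨ A.det = -1) : isIntMat A⁻¹ := by
  intro i j
  obtain ⟨k, hk⟩ := hA.adjugate i j
  rw [Matrix.inv_def, Ring.inverse_eq_inv']
  rcases hdet with h | h
  · exact ⟨k, by simp [h, hk]⟩
  · exact ⟨-k, by simp [h, hk, inv_neg]⟩

/-- The additive subgroup generated by two rational numbers is cyclic. -/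
theorem exists_common_generator (a b : ℚ) :
    ∃ (q : ℚ) (x y u v : ℤ), a = q * x ∧ b = q * y ∧ q = u * a + v * b := by
  obtain ⟨x, hx⟩ := Int.gcd_dvd_left (a.num * b.den) (b.num * a.den)
  obtain ⟨y, hy⟩ := Int.gcd_dvd_right (a.num * b.den) (b.num * a.den)
  have hg := Int.gcd_eq_gcd_ab (a.num * b.den) (b.num * a.den)
  set g : ℤ := (Int.gcd (a.num * b.den) (b.num * a.den) : ℤ)
  have had : (a.den : ℚ) ≠ 0 := by exact_mod_cast a.den_ne_zero
  have hbd : (b.den : ℚ) ≠ 0 := by exact_mod_cast b.den_ne_zero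
  have ha : a * a.den = a.num := Rat.mul_den_eq_num a
  have hb : b * b.den = b.num := Rat.mul_den_eq_num b
  have hx' : (a.num * b.den : ℚ) = g * x := by exact_mod_cast hx
  have hy' : (b.num * a.den : ℚ) = g * y := by exact_mod_cast hy
  set u := Int.gcdA (a.num * b.den) (b.num * a.den)
  set v := Int.gcdB (a.num * b.den) (b.num * a.den)
  have hg' : (g : ℚ) = a.num * b.den * u + b.num * a.den * v := by exact_mod_cast hg
  refine ⟨g / (a.den * b.den), x, y, u, v, ?_, ?_, ?_⟩
  · rw [div_mul_eq_mul_div, eq_div_iff (mul_ne_zero had hbd)]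
    linear_combination hx' + b.den * ha
  · rw [div_mul_eq_mul_div, eq_div_iff (mul_ne_zero had hbd)]
    linear_combination hy' + a.den * hb
  · rw [div_eq_iff (mul_ne_zero had hbd)]
    linear_combination hg' - b.den * u * ha - a.den * v * hb

/-- Every rational matrix is a rational multiple of an integer matrix, where the scalar is an
integer combination of the entries of the matrix. -/
theorem exists_content (A : Matrix (Fin 2) (Fin 2) ℚ) :
    ∃ (q : ℚ) (u c : Matrix (Fin 2) (Fin 2) ℤ),
      (∀ i j, A i j = q * u i j) ∧ q = ∑ i, ∑ j, c i j * A i j := by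
  obtain ⟨q₁, x₁, y₁, u₁, v₁, ha, hb, h₁⟩ := exists_common_generator (A 0 0) (A 0 1)
  obtain ⟨q₂, x₂, y₂, u₂, v₂, hc, hd, h₂⟩ := exists_common_generator (A 1 0) (A 1 1)
  obtain ⟨q, x, y, u, v, hq₁, hq₂, hq⟩ := exists_common_generator q₁ q₂
  refine ⟨q, !![x * x₁, x * y₁; y * x₂, y * y₂], !![u * u₁, u * v₁; v * u₂, v * v₂], ?_, ?_⟩
  · intro i j
    fin_cases i <;> fin_cases j <;> simp
    · rw [ha, hq₁]; ring
    · rw [hb, hq₁]; ring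
    · rw [hc, hq₂]; ring
    · rw [hd, hq₂]; ring
  · simp [Fin.sum_univ_two]
    linear_combination hq + u * h₁ + v * h₂

/-- If conjugation by `γ` preserves integrality, then `det γ` divides all products of two
entries of `γ`. -/
theorem exists_int_mul_det {γ : Matrix (Fin 2) (Fin 2) ℚ} (hγ : γ.det ≠ 0)
    (h : ∀ A, isIntMat A → isIntMat (γ * A * γ⁻¹)) (i j k l : Fin 2) :
    ∃ z : ℤ, γ i j * γ k l = z * γ.det := by
  have key (i j k l : Fin 2) : ∃ z : ℤ, γ i j * γ.adjugate k l = z * γ.det := by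
    have hs : isIntMat (Matrix.single j k (1 : ℚ)) := fun a b =>
      ⟨Matrix.single j k (1 : ℤ) a b, by simp [Matrix.single_apply]⟩
    obtain ⟨z, hz⟩ := h _ hs i l
    refine ⟨z, ?_⟩
    rw [← hz, Matrix.mul_assoc, Matrix.mul_apply, Finset.sum_eq_single j]
    · simp [Matrix.inv_def, Ring.inverse_eq_inv']
      field_simp
    · intro b _ hb
      simp [Matrix.single_mul_apply_of_ne, hb]
    · simp
  rw [Matrix.adjugate_fin_two] at key
  fin_cases k <;> fin_cases l
  · simpa using key i j 1 1
  · obtain ⟨z, hz⟩ := key i j 0 1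
    exact ⟨-z, by simp at hz ⊢; linarith⟩
  · obtain ⟨z, hz⟩ := key i j 1 0
    exact ⟨-z, by simp at hz ⊢; linarith⟩
  · simpa using key i j 0 0

/-- `γ ∈ GL₂(ℚ)` satisfies `γ M₂(ℤ) γ⁻¹ = M₂(ℤ)` iff `γ = q·u` with
`q ∈ ℚ^×` and `u` an integer matrix with determinant `±1`: the normalizer of
`M₂(ℤ)` in `GL₂(ℚ)` is `ℚ^× · GL₂(ℤ)`. -/
theorem stmt_9 (γ : Matrix (Fin 2) (Fin 2) ℚ) (hγ : IsUnit γ.det) :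
    conjSet γ {A | isIntMat A} = {A | isIntMat A} ↔
      ∃ q : ℚ, q ≠ 0 ∧ ∃ u : Matrix (Fin 2) (Fin 2) ℚ,
        isIntMat u ∧ (u.det = 1 ∨ u.det = -1) ∧ γ = q • u := by
  constructor
  · intro h
    have hconj (A) (hA : isIntMat A) : isIntMat (γ * A * γ⁻¹) :=
      h.subset (Set.mem_image_of_mem _ hA)
    choose z hz using exists_int_mul_det hγ.ne_zero hconj
    obtain ⟨q, u, c, hu, hq⟩ := exists_content γ
    have hγu : γ = q • u.map (Int.cast : ℤ → ℚ) := by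
      ext i j
      simp [hu]
    have hdet : γ.det = q ^ 2 * (u.det : ℚ) := by
      simp [Matrix.det_fin_two, hu]
      ring
    have hq0 : q ≠ 0 := by
      rintro rfl
      exact hγ.ne_zero (by simp [hdet])
    have hsq : q ^ 2 =
        ((∑ i, ∑ j, ∑ k, ∑ l, c i j * c k l * z i j k l : ℤ) : ℚ) * γ.det := by
      rw [sq]
      nth_rw 1 [hq]
      rw [hq]
      push_cast
      simp only [Finset.sum_mul, Finset.mul_sum]
      simp only [mul_assoc, ← hz]
      simp only [Fin.sum_univ_two]
      ring
    have hunit : (∑ i, ∑ j, ∑ k, ∑ l, c i j * c k l * z i j k l) * u.det = 1 := by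
      rw [hdet] at hsq
      have : q ^ 2 ≠ 0 := pow_ne_zero 2 hq0
      have h1 : ((∑ i, ∑ j, ∑ k, ∑ l, c i j * c k l * z i j k l : ℤ) : ℚ) * (u.det : ℚ) = 1 :=
        mul_left_cancel₀ this (by linear_combination -hsq)
      exact_mod_cast h1
    have hudet : (u.map (Int.cast : ℤ → ℚ)).det = (u.det : ℚ) := by
      simp [Matrix.det_fin_two]
    refine ⟨q, hq0, u.map Int.cast, fun i j => ⟨u i j, rfl⟩, ?_, hγu⟩
    rw [hudet]
    rcases Int.isUnit_iff.mp (IsUnit.of_mul_eq_one_right _ hunit) with h1 | h1 <;> simp [h1]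
  · rintro ⟨q, hq, u, hu, hdet, rfl⟩
    have hud : IsUnit u.det := by
      rcases hdet with h | h <;> simp [h]
    have hinv := hu.inv hdet
    have hqinv : (q • u)⁻¹ = q⁻¹ • u⁻¹ :=
      Matrix.inv_eq_left_inv (by simp [Matrix.nonsing_inv_mul u hud, hq])
    have hconj (A : Matrix (Fin 2) (Fin 2) ℚ) : (q • u) * A * (q • u)⁻¹ = u * A * u⁻¹ := by
      simp [hqinv, hq]
    ext B
    simp only [conjSet, hconj, Set.mem_image, Set.mem_ofPred_eq]
    constructor
    · rintro ⟨A, hA, rfl⟩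
      exact (hu.mul hA).mul hinv
    · intro hB
      refine ⟨u⁻¹ * B * u, (hinv.mul hB).mul hu, ?_⟩
      rw [Matrix.mul_assoc, Matrix.mul_assoc, Matrix.mul_nonsing_inv u hud, Matrix.mul_one,
        ← Matrix.mul_assoc, Matrix.mul_nonsing_inv u hud, Matrix.one_mul]
end

section
/- Fix a positive integer n. Let L₀ = {[[2nb, 2c],[2na, −2nb]] : a, b, c ∈ ℤ} ⊆ M₂(ℚ) with the bilinear form B(X, Y) = (1/(4n))·Tr(XY), and L₀^∨ = {X ∈ M₂(ℚ) : Tr(X) = 0 and B(X, A) ∈ ℤ for all A ∈ L₀}. Let N and M be coprime positive integers with N·M = n, let a, b ∈ ℤ with aN − bM = 1, and put γ = [[aN, b],[n, N]]. Then γ L₀ γ⁻¹ = L₀, and for every X ∈ L₀^∨ one has γ X γ⁻¹ − (aN + bM)·X ∈ L₀; that is, conjugation by γ acts on the discriminant group L₀^∨/L₀ (which is cyclic of order 2n) as multiplication by aN + bM. -/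
/-- The lattice `L₀ = {[[2nb, 2c], [2na, −2nb]] : a, b, c ∈ ℤ} ⊆ M₂(ℚ)`. -/
def memL0 (n : ℕ) (X : Matrix (Fin 2) (Fin 2) ℚ) : Prop :=
  ∃ a b c : ℤ,
    X = !![2 * (n : ℚ) * (b : ℚ), 2 * (c : ℚ);
           2 * (n : ℚ) * (a : ℚ), -(2 * (n : ℚ) * (b : ℚ))]

/-- The dual lattice `L₀^∨` with respect to the form `B(X, Y) = (1/(4n))·Tr(XY)`:
trace-zero matrices pairing integrally with `L₀`. -/
def memL0dual (n : ℕ) (X : Matrix (Fin 2) (Fin 2) ℚ) : Prop :=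
  X.trace = 0 ∧ ∀ A, memL0 n A → ∃ k : ℤ, (1 / (4 * (n : ℚ))) * (X * A).trace = (k : ℚ)

/-- Conjugation of a trace-zero matrix by an Atkin–Lehner matrix. -/
lemma atkinLehner_conj {N M a b : ℚ} (hN : N ≠ 0) (hab : a * N - b * M = 1) (x y z : ℚ) :
    !![a * N, b; N * M, N] * !![x, y; z, -x] * (!![a * N, b; N * M, N])⁻¹ =
      !![(a * N + b * M) * x + b * z - N * M * a * y,
          -(2 * a * b * x) - b ^ 2 * (z / N) + a ^ 2 * N * y;
        2 * (N * M) * x + N * z - N * M * M * y,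
          -((a * N + b * M) * x + b * z - N * M * a * y)] := by
  have hdet : (!![a * N, b; N * M, N]).det = N := by
    rw [Matrix.det_fin_two_of]
    linear_combination N * hab
  rw [Matrix.inv_def, hdet, Matrix.adjugate_fin_two_of, Ring.inverse_eq_inv']
  ext i j
  fin_cases i <;> fin_cases j <;>
    simp [Matrix.mul_apply, Fin.sum_univ_two] <;> field_simp <;> ring

/-- Elements of the dual lattice have the form `[[p, 2q], [2nr, -p]]` with `p, q, r ∈ ℤ`. -/
lemma memL0dual.exists_eq {n : ℕ} (hn : n ≠ 0) {X : Matrix (Fin 2) (Fin 2) ℚ}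
    (hX : memL0dual n X) :
    ∃ p q r : ℤ, X = !![(p : ℚ), 2 * (q : ℚ); 2 * (n : ℚ) * (r : ℚ), -(p : ℚ)] := by
  have hn' : (n : ℚ) ≠ 0 := Nat.cast_ne_zero.mpr hn
  obtain ⟨htr, h⟩ := hX
  obtain ⟨p, hp⟩ := h _ ⟨0, 1, 0, rfl⟩
  obtain ⟨q, hq⟩ := h _ ⟨1, 0, 0, rfl⟩
  obtain ⟨r, hr⟩ := h _ ⟨0, 0, 1, rfl⟩
  rw [Matrix.trace_fin_two] at htr
  simp only [Matrix.trace_fin_two, Matrix.mul_apply, Fin.sum_univ_two, Matrix.of_apply,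
    Matrix.cons_val', Matrix.cons_val_zero, Matrix.cons_val_one, Matrix.cons_val_fin_one,
    Int.cast_zero, Int.cast_one, mul_zero, mul_one, neg_zero, add_zero, zero_add] at hp hq hr
  field_simp at hp hq hr
  refine ⟨p, q, r, ?_⟩
  ext i j
  fin_cases i <;> fin_cases j <;> simp <;> linarith

/-- for coprime positive `N, M` with `N·M = n`, `aN − bM = 1` and the
Atkin–Lehner matrix `γ = [[aN, b], [n, N]]`, conjugation by `γ` preserves `L₀` and acts
on the discriminant group `L₀^∨/L₀` as multiplication by `aN + bM`. -/
theorem stmt_11 (n N M : ℕ) (hn : 0 < n) (hN : 0 < N) (hM : 0 < M)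
    (hcop : Nat.Coprime N M) (hNM : N * M = n) (a b : ℤ)
    (hab : a * (N : ℤ) - b * (M : ℤ) = 1) :
    ((fun X => !![(a : ℚ) * (N : ℚ), (b : ℚ); (n : ℚ), (N : ℚ)] * X *
        (!![(a : ℚ) * (N : ℚ), (b : ℚ); (n : ℚ), (N : ℚ)])⁻¹) '' {X | memL0 n X} =
      {X | memL0 n X}) ∧
    (∀ X, memL0dual n X →
      memL0 n (!![(a : ℚ) * (N : ℚ), (b : ℚ); (n : ℚ), (N : ℚ)] * X *
        (!![(a : ℚ) * (N : ℚ), (b : ℚ); (n : ℚ), (N : ℚ)])⁻¹ -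
        ((a * (N : ℤ) + b * (M : ℤ) : ℤ) : ℚ) • X)) := by
  have hN' : (N : ℚ) ≠ 0 := Nat.cast_ne_zero.mpr hN.ne'
  have habQ : (a : ℚ) * N - b * M = 1 := mod_cast hab
  subst hNM
  simp only [Nat.cast_mul]
  refine ⟨Set.Subset.antisymm ?_ ?_, ?_⟩
  · rintro _ ⟨_, ⟨A, B, C, rfl⟩, rfl⟩
    refine ⟨2 * (N * M) * B + N * A - M * C, (a * N + b * M) * B + b * A - a * C,
      -(2 * a * b * (N * M) * B) - b ^ 2 * M * A + a ^ 2 * N * C, ?_⟩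
    simp only [Nat.cast_mul]
    rw [atkinLehner_conj hN' habQ]
    ext i j
    fin_cases i <;> fin_cases j <;> simp <;> field_simp <;> ring
  · rintro _ ⟨A, B, C, rfl⟩
    refine ⟨_, ⟨-(2 * a * (N * M) * B) + a ^ 2 * N * A - M * C, (a * N + b * M) * B - a * b * A + C,
      2 * b * (N * M) * B - b ^ 2 * M * A + N * C, rfl⟩, ?_⟩
    simp only [Nat.cast_mul]
    rw [atkinLehner_conj hN' habQ]
    have ha : (a : ℚ) = (1 + b * M) / N := by
      rw [eq_div_iff hN']
      linear_combination habQ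
    ext i j
    fin_cases i <;> fin_cases j <;> simp [ha] <;> field_simp <;> ring
  · intro X hX
    obtain ⟨p, q, r, rfl⟩ := hX.exists_eq hn.ne'
    refine ⟨p + N * r - M * q - (a * N + b * M) * r, b * r - a * q,
      -(a * b * p) - b ^ 2 * M * r + a ^ 2 * N * q - (a * N + b * M) * q, ?_⟩
    simp only [Nat.cast_mul]
    rw [atkinLehner_conj hN' habQ]
    ext i j
    fin_cases i <;> fin_cases j <;> simp <;> field_simp <;> ring
end

section
/- Fix a positive integer n. Define a function e on ℙ¹(ℚ) by e([s : r]) = gcd(r, n), where r, s are coprime integers representing the point (with the convention gcd(0, n) = n, so e([1 : 0]) = n). Then: (i) e is well defined, i.e. independent of the coprime integer representative; (ii) e is constant on Γ₀(n)-orbits: e(γ·x) = e(x) for all γ ∈ Γ₀(n) and x ∈ ℙ¹(ℚ); (iii) if W = [[0, −1],[n, 0]] is the Fricke matrix, then e(W·x) = n / e(x) for every x ∈ ℙ¹(ℚ). -/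
/-- Membership in `Γ₀(n)`, viewed inside `M₂(ℚ)`. -/
def InGamma0 (n : ℕ) (γ : Matrix (Fin 2) (Fin 2) ℚ) : Prop :=
  ∃ a b c d : ℤ, (n : ℤ) ∣ c ∧ a * d - b * c = 1 ∧
    γ = !![(a : ℚ), (b : ℚ); (c : ℚ), (d : ℚ)]

/-- The level `e([s : r]) = gcd(r, n)` of the cusp spanned by a nonzero vector `v` of `ℚ²`,
read off from the slope `v 1 / v 0` in lowest terms. -/
def cuspLevel (n : ℕ) (v : Fin 2 → ℚ) : ℕ :=
  if v 0 = 0 then 1 else Int.gcd (v 1 / v 0).num n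

theorem cuspLevel_smul (n : ℕ) (v : Fin 2 → ℚ) {q : ℚ} (hq : q ≠ 0) :
    cuspLevel n (q • v) = cuspLevel n v := by
  simp [cuspLevel, hq, mul_div_mul_left]

theorem cuspLevel_of_isCoprime (n : ℕ) {r s : ℤ} (h : IsCoprime r s) :
    cuspLevel n ![(s : ℚ), (r : ℚ)] = Int.gcd r n := by
  rcases eq_or_ne s 0 with rfl | hs
  · have hr : r.natAbs = 1 := Int.isUnit_iff_natAbs_eq.mp (isCoprime_zero_right.mp h)
    simp [cuspLevel, Int.gcd, hr]
  · have hnum : ((r : ℚ) / s).num.natAbs = r.natAbs := by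
      rw [← Rat.divInt_eq_div, Rat.num_divInt, Int.isCoprime_iff_gcd_eq_one.mp h.symm]
      simp [Int.natAbs_mul, Int.natAbs_sign_of_ne_zero hs]
    simp [cuspLevel, hs, Int.gcd, hnum]

/-- Every nonzero vector of `ℚ²` is a scalar multiple of a primitive integral vector. -/
theorem exists_eq_smul_isCoprime {v : Fin 2 → ℚ} (hv : v ≠ 0) :
    ∃ (q : ℚ) (r s : ℤ), q ≠ 0 ∧ IsCoprime r s ∧ v = q • ![(s : ℚ), (r : ℚ)] := by
  rcases eq_or_ne (v 0) 0 with h0 | h0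
  · refine ⟨v 1, 1, 0, fun h1 => hv ?_, isCoprime_one_left, ?_⟩
    · ext i; fin_cases i <;> simp [h0, h1]
    · ext i; fin_cases i <;> simp [h0]
  · have hd : ((v 1 / v 0).den : ℚ) ≠ 0 := by exact_mod_cast (v 1 / v 0).den_nz
    refine ⟨v 0 / (v 1 / v 0).den, (v 1 / v 0).num, (v 1 / v 0).den, div_ne_zero h0 hd,
      (v 1 / v 0).isCoprime_num_den, ?_⟩
    ext i
    fin_cases i
    · simp [hd]
    · have := Rat.num_div_den (v 1 / v 0)
      simp only [Fin.mk_one, Pi.smul_apply, Matrix.cons_val_one, Matrix.cons_val_fin_one,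
        smul_eq_mul]
      rw [div_mul_eq_mul_div, mul_div_assoc, this, mul_div_cancel₀ _ h0]

theorem cuspLevel_smul_of_isCoprime (n : ℕ) {q : ℚ} (hq : q ≠ 0) {r s : ℤ} (h : IsCoprime r s) :
    cuspLevel n (q • ![(s : ℚ), (r : ℚ)]) = Int.gcd r n := by
  rw [cuspLevel_smul n _ hq, cuspLevel_of_isCoprime n h]

theorem cuspLevel_mulVec_of_inGamma0 (n : ℕ) {γ : Matrix (Fin 2) (Fin 2) ℚ} (hγ : InGamma0 n γ)
    {v : Fin 2 → ℚ} (hv : v ≠ 0) : cuspLevel n (γ.mulVec v) = cuspLevel n v := by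
  obtain ⟨a, b, c, d, ⟨k, rfl⟩, hdet, rfl⟩ := hγ
  obtain ⟨q, r, s, hq, ⟨x, y, hxy⟩, rfl⟩ := exists_eq_smul_isCoprime hv
  have hcop : IsCoprime (n * k * s + d * r) (a * s + b * r) :=
    ⟨x * a - y * b, y * d - x * (n * k), by linear_combination hxy + (x * r + y * s) * hdet⟩
  have hdn : IsCoprime d (n : ℤ) := ⟨a, -(b * k), by linear_combination hdet⟩
  have hmul : Matrix.mulVec !![(a : ℚ), (b : ℚ); ((n * k : ℤ) : ℚ), (d : ℚ)]
      (q • ![(s : ℚ), (r : ℚ)])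
      = q • ![((a * s + b * r : ℤ) : ℚ), ((n * k * s + d * r : ℤ) : ℚ)] := by
    rw [Matrix.mulVec_smul]
    congr 1
    ext i; fin_cases i <;> simp <;> ring
  rw [hmul, cuspLevel_smul_of_isCoprime n hq hcop, cuspLevel_smul_of_isCoprime n hq ⟨x, y, hxy⟩,
    mul_assoc, add_comm, Int.gcd_add_mul_left_left,
    Int.gcd_mul_right_left_of_gcd_eq_one (Int.isCoprime_iff_gcd_eq_one.mp hdn)]

theorem cuspLevel_fricke {n : ℕ} (hn : 0 < n) {v : Fin 2 → ℚ} (hv : v ≠ 0) :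
    cuspLevel n ((!![(0 : ℚ), -1; (n : ℚ), 0]).mulVec v) = n / cuspLevel n v := by
  obtain ⟨q, r, s, hq, hrs, rfl⟩ := exists_eq_smul_isCoprime hv
  rw [cuspLevel_smul_of_isCoprime n hq hrs]
  have hg : 0 < Int.gcd r n := Int.gcd_pos_of_ne_zero_right r (by exact_mod_cast hn.ne')
  obtain ⟨g, hgdef⟩ : ∃ g, g = Int.gcd r n := ⟨_, rfl⟩
  rw [← hgdef] at hg ⊢
  obtain ⟨r', hr'⟩ : (g : ℤ) ∣ r := hgdef ▸ Int.gcd_dvd_left r n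
  obtain ⟨m, hm⟩ : g ∣ n := Int.natCast_dvd_natCast.mp (hgdef ▸ Int.gcd_dvd_right r n)
  subst hr' hm
  have hr'm : IsCoprime r' (m : ℤ) := by
    rw [Nat.cast_mul, Int.gcd_mul_left, Int.natAbs_natCast] at hgdef
    exact Int.isCoprime_iff_gcd_eq_one.mpr (Nat.eq_of_mul_eq_mul_left hg (by omega))
  have hcop : IsCoprime (m * s) (-r') :=
    (hr'm.symm.mul_left hrs.of_mul_left_right.symm).neg_right
  have hg0 : (g : ℚ) ≠ 0 := by exact_mod_cast hg.ne'
  have hmul : (!![(0 : ℚ), -1; ((g * m : ℕ) : ℚ), 0]).mulVec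
      (q • ![(s : ℚ), ((g * r' : ℤ) : ℚ)])
      = (q * g) • ![((-r' : ℤ) : ℚ), ((m * s : ℤ) : ℚ)] := by
    ext i; fin_cases i <;> simp [Matrix.mulVec, dotProduct, Fin.sum_univ_two] <;> ring
  rw [hmul, cuspLevel_smul_of_isCoprime _ (mul_ne_zero hq hg0) hcop, Nat.mul_div_cancel_left _ hg,
    Nat.cast_mul, mul_comm (g : ℤ), Int.gcd_mul_left,
    Int.isCoprime_iff_gcd_eq_one.mp hrs.of_mul_left_left.symm, mul_one, Int.natAbs_natCast]

/-- there is a well-defined function `e` on `ℙ¹(ℚ)` (modelled as a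
function on nonzero vectors of `ℚ²`, invariant under scaling) with
`e([s : r]) = gcd(r, n)` for coprime integers `r, s`, which is `Γ₀(n)`-invariant
and satisfies `e(W·x) = n / e(x)` for the Fricke matrix `W = [[0, −1], [n, 0]]`. -/
theorem stmt_12 (n : ℕ) (hn : 0 < n) :
    ∃ e : (Fin 2 → ℚ) → ℕ,
      (∀ r s : ℤ, IsCoprime r s → e ![(s : ℚ), (r : ℚ)] = Int.gcd r (n : ℤ)) ∧
      (∀ v : Fin 2 → ℚ, v ≠ 0 → ∀ q : ℚ, q ≠ 0 → e (q • v) = e v) ∧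
      (∀ γ : Matrix (Fin 2) (Fin 2) ℚ, InGamma0 n γ →
        ∀ v : Fin 2 → ℚ, v ≠ 0 → e (γ.mulVec v) = e v) ∧
      (∀ v : Fin 2 → ℚ, v ≠ 0 →
        e ((!![(0 : ℚ), -1; (n : ℚ), 0]).mulVec v) = n / e v) := by
  exact ⟨cuspLevel n, fun _ _ => cuspLevel_of_isCoprime n, fun v _ _ => cuspLevel_smul n v,
    fun _ hγ _ => cuspLevel_mulVec_of_inGamma0 n hγ, fun _ => cuspLevel_fricke hn⟩
end

section
/- Fix a positive integer n. The action of Γ₀(n) on the projective line ℙ¹(ℚ) has finitely many orbits, and the number of orbits equals the sum over the positive divisors e of n of φ(gcd(e, n/e)), where φ is Euler's totient function. -/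
/-- Two nonzero vectors of `ℚ²` represent the same `Γ₀(n)`-orbit on `ℙ¹(ℚ)`. -/
def cuspRel (n : ℕ) (v w : {v : Fin 2 → ℚ // v ≠ 0}) : Prop :=
  ∃ γ : Matrix (Fin 2) (Fin 2) ℚ, InGamma0 n γ ∧
    ∃ q : ℚ, q ≠ 0 ∧ (w : Fin 2 → ℚ) = q • γ.mulVec (v : Fin 2 → ℚ)

lemma cuspRel_equivalence (n : ℕ) : Equivalence (cuspRel n) where
  refl v := ⟨_, ⟨1, 0, 0, 1, by simp, by simp, rfl⟩, 1, one_ne_zero, by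
    ext i; fin_cases i <;> simp [dotProduct, Fin.sum_univ_two]⟩
  symm := by
    rintro v w ⟨_, ⟨a, b, c, d, hc, hdet, rfl⟩, q, hq, hw⟩
    refine ⟨_, ⟨d, -b, -c, a, by simpa using hc, by linear_combination hdet, rfl⟩,
      q⁻¹, inv_ne_zero hq, ?_⟩
    have hdet' : (a * d - b * c : ℚ) = 1 := by exact_mod_cast hdet
    rw [hw]
    ext i
    fin_cases i <;> simp [dotProduct, Fin.sum_univ_two] <;> field_simp
    · linear_combination -(v.1 0) * hdet'
    · linear_combination -(v.1 1) * hdet'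
  trans := by
    rintro u v w ⟨_, ⟨a, b, c, d, hc, hdet, rfl⟩, q, hq, hv⟩
      ⟨_, ⟨a', b', c', d', hc', hdet', rfl⟩, q', hq', hw⟩
    refine ⟨_, ⟨a' * a + b' * c, a' * b + b' * d, c' * a + d' * c, c' * b + d' * d,
      dvd_add (hc'.mul_right _) (hc.mul_left _),
      by linear_combination (a' * d' - b' * c') * hdet + hdet', rfl⟩,
      q' * q, mul_ne_zero hq' hq, ?_⟩
    rw [hw, hv]
    ext i
    fin_cases i <;> simp [dotProduct, Fin.sum_univ_two] <;> ring

/-- The coprime pairs of integers. -/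
abbrev CoprimePair : Type := {p : ℤ × ℤ // IsCoprime p.1 p.2}

/-- A coprime pair of integers as a nonzero vector of `ℚ²`. -/
def CoprimePair.toVec (p : CoprimePair) : {v : Fin 2 → ℚ // v ≠ 0} :=
  ⟨![(p.1.1 : ℚ), (p.1.2 : ℚ)], fun h => by
    have h0 : p.1.1 = 0 := by simpa using congrFun h 0
    have h1 : p.1.2 = 0 := by simpa using congrFun h 1
    have := p.2
    rw [h0, h1] at this
    exact not_isCoprime_zero_zero this⟩

lemma cuspRel_toVec_iff (n : ℕ) (p p' : CoprimePair) :
    cuspRel n p.toVec p'.toVec ↔ ∃ a b c d : ℤ, (n : ℤ) ∣ c ∧ a * d - b * c = 1 ∧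
      p'.1.1 = a * p.1.1 + b * p.1.2 ∧ p'.1.2 = c * p.1.1 + d * p.1.2 := by
  obtain ⟨⟨x, y⟩, u, v, huv⟩ := p
  obtain ⟨⟨x', y'⟩, u', v', huv'⟩ := p'
  dsimp only at huv huv' ⊢
  constructor
  · rintro ⟨_, ⟨a, b, c, d, hc, hdet, rfl⟩, q, hq, hw⟩
    have h0 := congrFun hw 0
    have h1 := congrFun hw 1
    simp only [CoprimePair.toVec, Matrix.mulVec, dotProduct, Fin.sum_univ_two, Pi.smul_apply,
      smul_eq_mul, Matrix.cons_val_zero, Matrix.cons_val_one, Matrix.of_apply] at h0 h1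
    have hdetQ : (a * d - b * c : ℚ) = 1 := by exact_mod_cast hdet
    have huvQ : (u * x + v * y : ℚ) = 1 := by exact_mod_cast huv
    have huvQ' : (u' * x' + v' * y' : ℚ) = 1 := by exact_mod_cast huv'
    obtain ⟨m, rfl⟩ : ∃ m : ℤ, q = m :=
      ⟨u * (d * x' - b * y') + v * (a * y' - c * x'), by
        push_cast
        rw [h0, h1]
        linear_combination (-q) * huvQ - q * (u * x + v * y) * hdetQ⟩
    have hm : m * (u' * (a * x + b * y) + v' * (c * x + d * y)) = 1 := by
      have : (m * (u' * (a * x + b * y) + v' * (c * x + d * y)) : ℚ) = 1 := by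
        rw [h0, h1] at huvQ'
        linear_combination huvQ'
      exact_mod_cast this
    norm_cast at h0 h1
    rcases Int.isUnit_iff.mp (IsUnit.of_mul_eq_one _ hm) with rfl | rfl
    · exact ⟨a, b, c, d, hc, hdet, by linarith, by linarith⟩
    · exact ⟨-a, -b, -c, -d, by simpa using hc, by linarith, by linarith, by linarith⟩
  · rintro ⟨a, b, c, d, hc, hdet, h0, h1⟩
    refine ⟨_, ⟨a, b, c, d, hc, hdet, rfl⟩, 1, one_ne_zero, ?_⟩
    ext i
    fin_cases i <;>
      simp [CoprimePair.toVec, h0, h1, mul_comm]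

lemma exists_cuspRel_toVec (n : ℕ) (v : {v : Fin 2 → ℚ // v ≠ 0}) :
    ∃ p : CoprimePair, cuspRel n v p.toVec := by
  suffices ∃ p : CoprimePair, ∃ q : ℚ, q ≠ 0 ∧ (p.1.1 : ℚ) = q * v.1 0 ∧
      (p.1.2 : ℚ) = q * v.1 1 by
    obtain ⟨p, q, hq, h0, h1⟩ := this
    refine ⟨p, _, ⟨1, 0, 0, 1, by simp, by simp, rfl⟩, q, hq, ?_⟩
    ext i
    fin_cases i <;>
      simp [CoprimePair.toVec, dotProduct, Fin.sum_univ_two, h0, h1]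
  by_cases h1 : v.1 1 = 0
  · have h0 : v.1 0 ≠ 0 := fun h0 => v.2 (by ext i; fin_cases i <;> simp [h0, h1])
    exact ⟨⟨(1, 0), isCoprime_one_left⟩, (v.1 0)⁻¹, inv_ne_zero h0, by simp [h0], by simp [h1]⟩
  · refine ⟨⟨((v.1 0 / v.1 1).num, (v.1 0 / v.1 1).den), Rat.isCoprime_num_den _⟩,
      (v.1 0 / v.1 1).den / v.1 1, div_ne_zero (by simp) h1, ?_, ?_⟩
    · dsimp only
      rw [div_mul_eq_mul_div, mul_div_assoc, ← Rat.den_mul_eq_num]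
    · simp [h1]

/-- The invariant `(e, x (y / e) mod gcd(e, n / e))`, with `e = gcd(y, n)`, of the cusp
`[x : y]` of `Γ₀(n)`. -/
def cuspInvariant (n : ℕ) (p : CoprimePair) : Σ _ : ℕ, ℕ :=
  let e := Int.gcd p.1.2 n
  ⟨e, (p.1.1 * (p.1.2 / e) % (Nat.gcd e (n / e) : ℕ)).toNat⟩

lemma toNat_emod_eq_iff {a b : ℤ} {m : ℕ} (hm : 0 < m) :
    (a % m).toNat = (b % m).toNat ↔ (m : ℤ) ∣ a - b := by
  have ha := Int.emod_nonneg a (Int.natCast_ne_zero.mpr hm.ne')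
  have hb := Int.emod_nonneg b (Int.natCast_ne_zero.mpr hm.ne')
  rw [Int.dvd_iff_emod_eq_zero, ← Int.emod_eq_emod_iff_emod_sub_eq_zero]
  omega

lemma exists_eq_gcd_mul {n : ℕ} (hn : 0 < n) (y : ℤ) :
    ∃ (s : ℤ) (k : ℕ), y = Int.gcd y n * s ∧ n = Int.gcd y n * k ∧ IsCoprime s k := by
  have he : 0 < Int.gcd y n := Int.gcd_pos_of_ne_zero_right _ (by exact_mod_cast hn.ne')
  obtain ⟨s, hs⟩ := Int.gcd_dvd_left y n
  obtain ⟨k, hk⟩ : Int.gcd y n ∣ n := by exact_mod_cast Int.gcd_dvd_right y n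
  refine ⟨s, k, hs, hk, ?_⟩
  obtain ⟨u, v, huv⟩ : ∃ u v : ℤ, (Int.gcd y n : ℤ) = y * u + n * v :=
    ⟨_, _, Int.gcd_eq_gcd_ab y n⟩
  have hk' : (n : ℤ) = Int.gcd y n * k := by exact_mod_cast hk
  have he' : (Int.gcd y n : ℤ) ≠ 0 := by exact_mod_cast he.ne'
  generalize Int.gcd y n = e at *
  refine ⟨u, v, mul_left_cancel₀ he' ?_⟩
  rw [hs, hk'] at huv
  linear_combination -huv

lemma gcd_eq_of_gamma0 {n : ℕ} {x y x' y' a b c d : ℤ} (hc : (n : ℤ) ∣ c)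
    (hdet : a * d - b * c = 1) (hx : x' = a * x + b * y) (hy : y' = c * x + d * y) :
    Int.gcd y n = Int.gcd y' n := by
  have key : ∀ {x y y' c d : ℤ}, (n : ℤ) ∣ c → y' = c * x + d * y →
      Int.gcd y n ∣ Int.gcd y' n := by
    rintro x y y' c d hc rfl
    refine Int.dvd_gcd ?_ (Int.gcd_dvd_right _ _)
    exact dvd_add (((Int.gcd_dvd_right _ _).trans hc).mul_right _)
      ((Int.gcd_dvd_left _ _).mul_left _)
  refine Nat.dvd_antisymm (key hc hy) (key (x := x') (c := -c) (d := a) (by simpa using hc) ?_)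
  rw [hx, hy]
  linear_combination (-y) * hdet

lemma dvd_sub_of_gamma0 {e k g x s x' s' a b c d : ℤ} (he : e ≠ 0) (hge : g ∣ e) (hgk : g ∣ k)
    (hc : e * k ∣ c) (hdet : a * d - b * c = 1) (hx : x' = a * x + b * (e * s))
    (hy : e * s' = c * x + d * (e * s)) : g ∣ x * s - x' * s' := by
  obtain ⟨c, rfl⟩ := hc
  obtain rfl : s' = k * c * x + d * s := mul_left_cancel₀ he (by linear_combination hy)
  obtain ⟨e, rfl⟩ := hge
  obtain ⟨k, rfl⟩ := hgk
  refine ⟨-(b * e * g * k * c * x * s) - a * x * k * c * x - b * e * s * g * k * c * x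
    - b * e * s * d * s, ?_⟩
  rw [hx]
  linear_combination (-(x * s)) * hdet

lemma exists_gamma0_of_dvd_sub {e k x s x' s' : ℤ} (hxs : IsCoprime x (e * s))
    (hxs' : IsCoprime x' (e * s')) (hs : IsCoprime s k) (hs' : IsCoprime s' k)
    (h : (Int.gcd e k : ℤ) ∣ x * s - x' * s') :
    ∃ a b c d : ℤ, e * k ∣ c ∧ a * d - b * c = 1 ∧ x' = a * x + b * (e * s) ∧
      e * s' = c * x + d * (e * s) := by
  obtain ⟨q, p, hqp⟩ := hxs
  obtain ⟨q', p', hqp'⟩ := hxs'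
  obtain ⟨t, m, htm⟩ : ∃ t m : ℤ, s' * q - q' * s = t * (e * s * s') + m * k := by
    obtain ⟨w, z, hwz⟩ := hs.mul_left hs'
    obtain ⟨α, β, hαβ⟩ : ∃ α β : ℤ, (Int.gcd e k : ℤ) = e * α + k * β :=
      ⟨_, _, Int.gcd_eq_gcd_ab e k⟩
    obtain ⟨j, hj⟩ : (Int.gcd e k : ℤ) ∣ s' * q - q' * s := by
      obtain ⟨f, hf⟩ := Int.gcd_dvd_left e k
      obtain ⟨j, hj⟩ := h
      generalize (Int.gcd e k : ℤ) = g at *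
      refine ⟨-(q * q' * j) + f * (s' * q * p' * s' - q' * s * p * s), ?_⟩
      linear_combination (-q * q') * hj - s' * q * hqp' + q' * s * hqp
        + (s' * q * p' * s' - q' * s * p * s) * hf
    refine ⟨α * j * w, β * j + e * α * j * z, ?_⟩
    rw [hj, hαβ]
    linear_combination (-(e * α * j)) * hwz
  refine ⟨x' * q - (-p' + t * x') * (e * s), x' * p + (-p' + t * x') * x,
    e * s' * q - (q' + t * (e * s')) * (e * s), e * s' * p + (q' + t * (e * s')) * x,
    ⟨m, ?_⟩, ?_, ?_, ?_⟩
  · linear_combination e * htm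
  · linear_combination (q * x + p * (e * s)) * hqp' + hqp
  · linear_combination (-x') * hqp
  · linear_combination (-(e * s')) * hqp

lemma cuspInvariant_eq_iff {n : ℕ} (hn : 0 < n) (p p' : CoprimePair) :
    cuspInvariant n p = cuspInvariant n p' ↔ cuspRel n p.toVec p'.toVec := by
  rw [cuspRel_toVec_iff]
  obtain ⟨⟨x, y⟩, hxy⟩ := p
  obtain ⟨⟨x', y'⟩, hxy'⟩ := p'
  obtain ⟨s, k, hs, hk, hsk⟩ := exists_eq_gcd_mul hn y
  obtain ⟨s', k', hs', hk', hsk'⟩ := exists_eq_gcd_mul hn y'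
  have he : 0 < Int.gcd y n := Int.gcd_pos_of_ne_zero_right _ (by exact_mod_cast hn.ne')
  have hnk : n / Int.gcd y n = k := Nat.div_eq_of_eq_mul_right he hk
  dsimp only at hxy hxy' ⊢
  simp only [cuspInvariant, Sigma.mk.injEq, heq_eq_eq]
  trans Int.gcd y n = Int.gcd y' n ∧
    ((Nat.gcd (Int.gcd y n) k : ℕ) : ℤ) ∣ x * s - x' * s'
  · refine and_congr_right fun hee => ?_
    have he0 : (Int.gcd y n : ℤ) ≠ 0 := by exact_mod_cast he.ne'
    have h1 : y / Int.gcd y n = s := Int.ediv_eq_of_eq_mul_right he0 hs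
    have h2 : y' / Int.gcd y n = s' := Int.ediv_eq_of_eq_mul_right he0 (hee ▸ hs')
    rw [← hee, hnk, h1, h2, toNat_emod_eq_iff (Nat.gcd_pos_of_pos_left _ he)]
  have hkZ : (n : ℤ) = Int.gcd y n * k := by exact_mod_cast hk
  constructor
  · rintro ⟨hee, h⟩
    obtain rfl : k' = k := by
      rw [← hee] at hk'
      exact Nat.eq_of_mul_eq_mul_left he (hk'.symm.trans hk)
    rw [← hee] at hs'
    rw [hs] at hxy
    rw [hs'] at hxy'
    rw [← Int.gcd_natCast_natCast] at h
    obtain ⟨a, b, c, d, hc, hdet, h0, h1⟩ := exists_gamma0_of_dvd_sub hxy hxy' hsk hsk' h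
    exact ⟨a, b, c, d, hkZ ▸ hc, hdet, by rwa [hs], by rw [hs', h1, ← hs]⟩
  · rintro ⟨a, b, c, d, hc, hdet, h0, h1⟩
    have hee := gcd_eq_of_gamma0 hc hdet h0 h1
    rw [← hee] at hs'
    exact ⟨hee, dvd_sub_of_gamma0 (e := Int.gcd y n) (k := k) (by exact_mod_cast he.ne')
      (by exact_mod_cast Nat.gcd_dvd_left _ _) (by exact_mod_cast Nat.gcd_dvd_right _ _)
      (hkZ ▸ hc) hdet (by rw [h0, ← hs]) (by rw [← hs', h1, ← hs])⟩

lemma exists_isCoprime_emod_eq {e g r : ℕ} (he : 0 < e) (hge : g ∣ e) (hr : r < g)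
    (hgr : g.Coprime r) : ∃ x : ℤ, IsCoprime x e ∧ x % g = r := by
  have : NeZero e := ⟨he.ne'⟩
  obtain ⟨u, hu⟩ := ZMod.unitsMap_surjective hge (ZMod.unitOfCoprime r hgr.symm)
  refine ⟨(u : ZMod e).val, Nat.isCoprime_iff_coprime.mpr (ZMod.val_coe_unit_coprime u), ?_⟩
  have h := congrArg Units.val hu
  rw [ZMod.unitsMap_val, ZMod.coe_unitOfCoprime, ZMod.cast_eq_val,
    ZMod.natCast_eq_natCast_iff', Nat.mod_eq_of_lt hr] at h
  exact_mod_cast h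

lemma range_cuspInvariant {n : ℕ} (hn : 0 < n) :
    Set.range (cuspInvariant n) = (n.divisors.sigma fun e =>
      {r ∈ Finset.range (Nat.gcd e (n / e)) | (Nat.gcd e (n / e)).Coprime r} :
        Finset (Σ _ : ℕ, ℕ)) := by
  ext ⟨e, r⟩
  simp only [Set.mem_range, Finset.mem_coe, Finset.mem_sigma, Nat.mem_divisors, Finset.mem_filter,
    Finset.mem_range]
  constructor
  · rintro ⟨⟨⟨x, y⟩, hxy⟩, h⟩
    obtain ⟨s, k, hs, hk, hsk⟩ := exists_eq_gcd_mul hn y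
    have he : 0 < Int.gcd y n := Int.gcd_pos_of_ne_zero_right _ (by exact_mod_cast hn.ne')
    have hnk : n / Int.gcd y n = k := Nat.div_eq_of_eq_mul_right he hk
    have h1 : y / Int.gcd y n = s :=
      Int.ediv_eq_of_eq_mul_right (by exact_mod_cast he.ne') hs
    simp only [cuspInvariant, Sigma.mk.injEq, heq_eq_eq, h1, hnk] at h
    obtain ⟨rfl, rfl⟩ := h
    rw [hnk]
    have hg : 0 < Nat.gcd (Int.gcd y n) k := Nat.gcd_pos_of_pos_left _ he
    have hg0 : ((Nat.gcd (Int.gcd y n) k : ℕ) : ℤ) ≠ 0 := by exact_mod_cast hg.ne'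
    have hr0 := Int.emod_nonneg (x * s) hg0
    refine ⟨⟨⟨k, hk⟩, hn.ne'⟩, ?_, ?_⟩
    · have := Int.emod_lt_of_pos (x * s) (by exact_mod_cast hg :
        (0 : ℤ) < (Nat.gcd (Int.gcd y n) k : ℕ))
      omega
    · rw [← Nat.isCoprime_iff_coprime, Int.toNat_of_nonneg hr0, Int.emod_def, sub_eq_add_neg,
        ← mul_neg, IsCoprime.add_mul_left_right_iff]
      refine IsCoprime.mul_right ?_ ?_
      · rw [hs] at hxy
        exact (hxy.of_mul_right_left.of_isCoprime_of_dvd_right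
          (by exact_mod_cast Nat.gcd_dvd_left _ _)).symm
      · exact (hsk.of_isCoprime_of_dvd_right (by exact_mod_cast Nat.gcd_dvd_right _ _)).symm
  · rintro ⟨⟨hen, -⟩, hr, hgr⟩
    have he := Nat.pos_of_dvd_of_pos hen hn
    obtain ⟨x, hxe, hxr⟩ := exists_isCoprime_emod_eq he (Nat.gcd_dvd_left _ _) hr hgr
    refine ⟨⟨(x, e), hxe⟩, ?_⟩
    have hgcd : Int.gcd e n = e := by
      rw [Int.gcd_natCast_natCast, Nat.gcd_eq_left hen]
    have he0 : (e : ℤ) ≠ 0 := by exact_mod_cast he.ne'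
    simp only [cuspInvariant, hgcd, Int.ediv_self he0, mul_one, hxr, Int.toNat_natCast]

/-- `Γ₀(n)` has finitely many orbits on `ℙ¹(ℚ)`, and the number of
orbits is `∑_{e ∣ n} φ(gcd(e, n/e))`. -/
theorem stmt_13 (n : ℕ) (hn : 0 < n) :
    Finite (Quot (cuspRel n)) ∧
    Nat.card (Quot (cuspRel n)) =
      ∑ e ∈ n.divisors, (Nat.gcd e (n / e)).totient := by
  have hker : Setoid.ker (fun p : CoprimePair => Quot.mk (cuspRel n) p.toVec) =
      Setoid.ker (cuspInvariant n) := by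
    ext p p'
    rw [Setoid.ker_def, Setoid.ker_def, cuspInvariant_eq_iff hn,
      (cuspRel_equivalence n).quot_mk_eq_iff]
  have hsurj : Function.Surjective (fun p : CoprimePair => Quot.mk (cuspRel n) p.toVec) := by
    rintro ⟨v⟩
    obtain ⟨p, hp⟩ := exists_cuspRel_toVec n v
    exact ⟨p, (Quot.sound hp).symm⟩
  have equiv : Quot (cuspRel n) ≃ Set.range (cuspInvariant n) :=
    (Setoid.quotientKerEquivOfSurjective _ hsurj).symm.trans
      ((Quotient.congrRight fun p p' => by rw [hker]).trans
        (Setoid.quotientKerEquivRange (cuspInvariant n)))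
  rw [range_cuspInvariant hn] at equiv
  refine ⟨Finite.of_equiv _ equiv.symm, ?_⟩
  rw [Nat.card_congr equiv, Nat.card_coe_set_eq, Set.ncard_coe_finset, Finset.card_sigma]
  rfl
end

section
/- Fix a positive integer n. Let G ≤ GL₂(ℚ) be the subgroup generated by Γ₀(n) and the Fricke matrix [[0, −1],[n, 0]]. Then the action of G on the projective line ℙ¹(ℚ) has finitely many orbits, and the number of orbits equals the sum, over all positive integers d with d² | n and d² < n, of φ(d)·2^{ω(n/d²) − 1}, plus s(n), where ω(m) denotes the number of distinct prime divisors of m, φ is Euler's totient function, and s(n) equals the number of orbits of the negation map u ↦ −u on the unit group (ℤ/dℤ)^× when n = d² is a perfect square, and s(n) = 0 when n is not a perfect square. -/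
/-- `Γ₀(n)` as a subset of `GL₂(ℚ)`. -/
def Gamma0GL (n : ℕ) : Set (GL (Fin 2) ℚ) :=
  {γ | InGamma0 n (γ : Matrix (Fin 2) (Fin 2) ℚ)}

/-- The Fricke matrix `W = [[0, −1], [n, 0]]` as an element of `GL₂(ℚ)`. -/
noncomputable def frickeGL (n : ℕ) (hn : 0 < n) : GL (Fin 2) ℚ :=
  Matrix.GeneralLinearGroup.mkOfDetNeZero !![(0 : ℚ), -1; (n : ℚ), 0] (by
    have h : ((n : ℚ)) ≠ 0 := Nat.cast_ne_zero.mpr hn.ne'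
    simp [Matrix.det_fin_two_of, h])

/-- Two nonzero vectors of `ℚ²` represent the same orbit on `ℙ¹(ℚ)` under the group
`G = ⟨Γ₀(n), W⟩` generated by `Γ₀(n)` and the Fricke matrix. -/
def frickeRel (n : ℕ) (hn : 0 < n) (v w : {v : Fin 2 → ℚ // v ≠ 0}) : Prop :=
  ∃ γ ∈ Subgroup.closure (Gamma0GL n ∪ {frickeGL n hn}),
    ∃ q : ℚ, q ≠ 0 ∧
      (w : Fin 2 → ℚ) = q • (γ : Matrix (Fin 2) (Fin 2) ℚ).mulVec (v : Fin 2 → ℚ)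

theorem card_filter_coprime_div (m : ℕ) (hm : m ≠ 0) :
    (m.divisors.filter (fun a => Nat.Coprime a (m / a))).card = 2 ^ m.primeFactors.card := by
  rw [← Finset.card_powerset]
  refine Finset.card_bij (fun a _ => a.primeFactors) ?_ ?_ ?_
  · intro a ha
    simp only [Finset.mem_filter, Nat.mem_divisors] at ha
    exact Finset.mem_powerset.2 (Nat.primeFactors_mono ha.1.1 hm)
  · intro a ha b hb hab
    simp only [Finset.mem_filter, Nat.mem_divisors] at ha hb
    have key : ∀ c, c ∣ m → Nat.Coprime c (m / c) → ∀ p ∈ c.primeFactors,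
        c.factorization p = m.factorization p := by
      intro c hc hcop p hp
      have h := Nat.factorization_eq_of_coprime_left hcop
        (by simpa [Nat.mem_primeFactors_iff_mem_primeFactorsList] using hp)
      rw [Nat.mul_div_cancel' hc] at h
      exact h.symm
    refine Nat.eq_of_factorization_eq (ne_zero_of_dvd_ne_zero hm ha.1.1)
      (ne_zero_of_dvd_ne_zero hm hb.1.1) fun p => ?_
    by_cases hp : p ∈ a.primeFactors
    · rw [key a ha.1.1 ha.2 p hp, key b hb.1.1 hb.2 p (hab ▸ hp)]
    · have hp' : p ∉ b.primeFactors := hab ▸ hp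
      rw [← Nat.support_factorization, Finsupp.notMem_support_iff] at hp hp'
      rw [hp, hp']
  · intro s hs
    rw [Finset.mem_powerset] at hs
    have hpr : ∀ p ∈ m.primeFactors, p.Prime := fun p hp => Nat.prime_of_mem_primeFactors hp
    have hprod : (∏ p ∈ s, p ^ m.factorization p) *
        ∏ p ∈ m.primeFactors \ s, p ^ m.factorization p = m := by
      rw [mul_comm, Finset.prod_sdiff hs]
      exact Nat.prod_factorization_pow_eq_self hm
    have hpos : 0 < ∏ p ∈ s, p ^ m.factorization p :=
      Finset.prod_pos fun p hp => pow_pos (hpr p (hs hp)).pos _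
    refine ⟨∏ p ∈ s, p ^ m.factorization p, ?_, ?_⟩
    · simp only [Finset.mem_filter, Nat.mem_divisors]
      refine ⟨⟨⟨_, hprod.symm⟩, hm⟩, ?_⟩
      have hdiv : m / (∏ p ∈ s, p ^ m.factorization p) =
          ∏ p ∈ m.primeFactors \ s, p ^ m.factorization p :=
        Nat.div_eq_of_eq_mul_right hpos hprod.symm
      rw [hdiv]
      refine Nat.Coprime.prod_left fun p hp => Nat.Coprime.prod_right fun q hq => ?_
      rw [Finset.mem_sdiff] at hq
      refine Nat.Coprime.pow _ _ ((Nat.coprime_primes (hpr p (hs hp)) (hpr q hq.1)).2 ?_)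
      rintro rfl
      exact hq.2 hp
    · ext p
      rw [Nat.mem_primeFactors]
      constructor
      · rintro ⟨hp, hd, -⟩
        obtain ⟨q, hq, hpq⟩ := (hp.prime.dvd_finsetProd_iff _).1 hd
        rwa [(Nat.prime_dvd_prime_iff_eq hp (hpr q (hs hq))).1 (hp.dvd_of_dvd_pow hpq)]
      · intro hp
        refine ⟨hpr p (hs hp), ?_, hpos.ne'⟩
        refine dvd_trans (dvd_pow_self p ?_) (Finset.dvd_prod_of_mem _ hp)
        rw [← Finsupp.mem_support_iff, Nat.support_factorization]
        exact hs hp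

theorem card_filter_coprime_div_sq_lt (m : ℕ) (hm : 1 < m) :
    (m.divisors.filter (fun a => Nat.Coprime a (m / a) ∧ a ^ 2 < m)).card =
      2 ^ (m.primeFactors.card - 1) := by
  have hm0 : m ≠ 0 := by omega
  have hU := card_filter_coprime_div m hm0
  have hlt : m.divisors.filter (fun a => Nat.Coprime a (m / a) ∧ a ^ 2 < m) =
      (m.divisors.filter (fun a => Nat.Coprime a (m / a))).filter (fun a => a ^ 2 < m) := by
    rw [Finset.filter_filter]
  have hbij : ((m.divisors.filter (fun a => Nat.Coprime a (m / a))).filter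
        (fun a => a ^ 2 < m)).card =
      ((m.divisors.filter (fun a => Nat.Coprime a (m / a))).filter
        (fun a => ¬ a ^ 2 < m)).card := by
    refine Finset.card_nbij' (fun a => m / a) (fun a => m / a) ?_ ?_ ?_ ?_
    · intro a ha
      simp only [Finset.coe_filter, Finset.mem_filter, Nat.mem_divisors, Set.mem_ofPred_eq] at ha ⊢
      obtain ⟨⟨⟨⟨b, rfl⟩, -⟩, hc⟩, hl⟩ := ha
      have ha0 : 0 < a := Nat.pos_of_ne_zero (by rintro rfl; simp at hm0)
      have hb0 : 0 < b := Nat.pos_of_ne_zero (by rintro rfl; simp at hm0)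
      rw [Nat.mul_div_cancel_left _ ha0] at hc ⊢
      rw [Nat.mul_div_cancel _ hb0]
      refine ⟨⟨⟨Dvd.intro_left a rfl, hm0⟩, hc.symm⟩, ?_⟩
      have : a < b := by nlinarith
      nlinarith
    · intro a ha
      simp only [Finset.coe_filter, Finset.mem_filter, Nat.mem_divisors, Set.mem_ofPred_eq] at ha ⊢
      obtain ⟨⟨⟨⟨b, rfl⟩, -⟩, hc⟩, hl⟩ := ha
      have ha0 : 0 < a := Nat.pos_of_ne_zero (by rintro rfl; simp at hm0)
      have hb0 : 0 < b := Nat.pos_of_ne_zero (by rintro rfl; simp at hm0)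
      rw [Nat.mul_div_cancel_left _ ha0] at hc ⊢
      rw [Nat.mul_div_cancel _ hb0]
      refine ⟨⟨⟨Dvd.intro_left a rfl, hm0⟩, hc.symm⟩, ?_⟩
      have h1 : b ≤ a := by nlinarith
      have h2 : b ≠ a := by
        rintro rfl
        rw [Nat.coprime_self] at hc
        subst hc
        simp at hm
      have : b < a := by omega
      nlinarith
    · intro a ha
      simp only [Finset.coe_filter, Finset.mem_filter, Nat.mem_divisors, Set.mem_ofPred_eq] at ha
      exact Nat.div_div_self ha.1.1.1 hm0
    · intro a ha
      simp only [Finset.coe_filter, Finset.mem_filter, Nat.mem_divisors, Set.mem_ofPred_eq] at ha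
      exact Nat.div_div_self ha.1.1.1 hm0
  have hsum := Finset.card_filter_add_card_filter_not
    (s := m.divisors.filter (fun a => Nat.Coprime a (m / a))) (fun a => a ^ 2 < m)
  have hω : 0 < m.primeFactors.card := Finset.card_pos.2 (Nat.nonempty_primeFactors.2 hm)
  obtain ⟨k, hk⟩ : ∃ k, m.primeFactors.card = k + 1 := ⟨_, (Nat.sub_add_cancel hω).symm⟩
  rw [hk, pow_succ] at hU
  rw [hlt, hk, Nat.add_sub_cancel]
  omega

theorem sum_totient_gcd_div (n : ℕ) (hn : 0 < n) :
    ∑ e ∈ n.divisors.filter (fun e => e ^ 2 < n), (Nat.gcd e (n / e)).totient =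
      ∑ d ∈ (Finset.range (n + 1)).filter (fun d => d ^ 2 ∣ n ∧ d ^ 2 < n),
        d.totient * 2 ^ ((n / d ^ 2).primeFactors.card - 1) := by
  rw [← Finset.sum_fiberwise_of_maps_to (g := fun e => Nat.gcd e (n / e))
    (t := (Finset.range (n + 1)).filter (fun d => d ^ 2 ∣ n ∧ d ^ 2 < n))]
  · refine Finset.sum_congr rfl fun d hd => ?_
    simp only [Finset.mem_filter, Finset.mem_range] at hd
    obtain ⟨-, ⟨m, rfl⟩, hlt⟩ := hd
    have hd0 : 0 < d := Nat.pos_of_ne_zero (by rintro rfl; simp at hn)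
    have hm : 1 < m := by
      by_contra h
      have : m ≤ 1 := by omega
      nlinarith [Nat.mul_le_mul_left (d ^ 2) this]
    rw [Finset.sum_congr rfl (g := fun _ => d.totient)
      (fun e he => by rw [(Finset.mem_filter.1 he).2]), Finset.sum_const, smul_eq_mul, mul_comm,
      Nat.mul_div_cancel_left _ (by positivity), ← card_filter_coprime_div_sq_lt m hm]
    congr 1
    symm
    refine Finset.card_bij (fun a _ => d * a) ?_ ?_ ?_
    · intro a ha
      simp only [Finset.mem_filter, Nat.mem_divisors] at ha ⊢
      obtain ⟨⟨⟨b, rfl⟩, hab⟩, hc, hl⟩ := ha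
      have ha0 : 0 < a := Nat.pos_of_ne_zero (by rintro rfl; simp at hab)
      rw [Nat.mul_div_cancel_left _ ha0] at hc
      have h : d ^ 2 * (a * b) = (d * a) * (d * b) := by ring
      refine ⟨⟨⟨⟨d * b, h⟩, hn.ne'⟩, ?_⟩, ?_⟩
      · rw [mul_pow]
        exact Nat.mul_lt_mul_of_pos_left hl (by positivity)
      · rw [h, Nat.mul_div_cancel_left _ (by positivity), Nat.gcd_mul_left, hc, mul_one]
    · intro a _ b _ hab
      exact Nat.eq_of_mul_eq_mul_left hd0 hab
    · intro e he
      simp only [Finset.mem_filter, Nat.mem_divisors] at he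
      obtain ⟨⟨⟨⟨g, hg⟩, -⟩, hl⟩, hgcd⟩ := he
      have he0 : 0 < e := Nat.pos_of_ne_zero (by rintro rfl; simp at hg; omega)
      rw [hg, Nat.mul_div_cancel_left _ he0] at hgcd
      obtain ⟨a, rfl⟩ : d ∣ e := hgcd ▸ Nat.gcd_dvd_left e g
      obtain ⟨b, rfl⟩ : d ∣ g := hgcd ▸ Nat.gcd_dvd_right (d * a) g
      have hab : m = a * b := by
        refine Nat.eq_of_mul_eq_mul_left (show 0 < d ^ 2 by positivity) ?_
        rw [hg]; ring
      have ha0 : 0 < a := Nat.pos_of_ne_zero (by rintro rfl; simp at he0)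
      refine ⟨a, ?_, rfl⟩
      simp only [Finset.mem_filter, Nat.mem_divisors]
      refine ⟨⟨⟨b, hab⟩, by omega⟩, ?_, ?_⟩
      · rw [hab, Nat.mul_div_cancel_left _ ha0]
        rw [Nat.gcd_mul_left] at hgcd
        exact Nat.eq_of_mul_eq_mul_left hd0 (by rw [hgcd, mul_one])
      · rw [mul_pow] at hl
        exact Nat.lt_of_mul_lt_mul_left hl
  · intro e he
    simp only [Finset.mem_filter, Nat.mem_divisors, Finset.mem_range] at he ⊢
    obtain ⟨⟨hd, -⟩, hl⟩ := he
    have he0 : 0 < e := Nat.pos_of_dvd_of_pos hd hn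
    have hle : Nat.gcd e (n / e) ≤ e := Nat.gcd_le_left _ he0
    have h2 : Nat.gcd e (n / e) ^ 2 ∣ n := by
      have := Nat.mul_dvd_mul (Nat.gcd_dvd_left e (n / e)) (Nat.gcd_dvd_right e (n / e))
      rwa [Nat.mul_div_cancel' hd, ← sq] at this
    refine ⟨?_, h2, ?_⟩
    · have := Nat.le_of_dvd hn hd
      omega
    · nlinarith

/-- The vector `v` spans the line `[x : e z]` with `x`, `e z` coprime and `z` coprime to `g`, and
`u` is congruent to `x z` modulo `gcd(e, g)`. The pair `(e, u)` is the invariant classifying the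
cusps of `Γ₀(e g)`. -/
def IsCuspWith (e g : ℕ) (u : ℤ) (v : Fin 2 → ℚ) : Prop :=
  ∃ x z : ℤ, ∃ q : ℚ, q ≠ 0 ∧ IsCoprime x (e * z) ∧ IsCoprime z g ∧
    v = q • ![(x : ℚ), (e : ℚ) * z] ∧ (Nat.gcd e g : ℤ) ∣ u - x * z

namespace IsCuspWith

variable {e g : ℕ} {u : ℤ} {v : Fin 2 → ℚ}

theorem smul (h : IsCuspWith e g u v) {c : ℚ} (hc : c ≠ 0) : IsCuspWith e g u (c • v) := by
  obtain ⟨x, z, q, hq, hx, hz, rfl, hu⟩ := h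
  exact ⟨x, z, c * q, mul_ne_zero hc hq, hx, hz, by rw [smul_smul], hu⟩

theorem of_dvd_sub (h : IsCuspWith e g u v) {u' : ℤ} (hu' : (Nat.gcd e g : ℤ) ∣ u' - u) :
    IsCuspWith e g u' v := by
  obtain ⟨x, z, q, hq, hx, hz, hv, hu⟩ := h
  refine ⟨x, z, q, hq, hx, hz, hv, ?_⟩
  have := dvd_add hu' hu
  rwa [sub_add_sub_cancel] at this

theorem isCoprime (h : IsCuspWith e g u v) : IsCoprime u (Nat.gcd e g : ℤ) := by
  obtain ⟨x, z, q, hq, hx, hz, hv, c, hc⟩ := h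
  have he : (Nat.gcd e g : ℤ) ∣ e := Int.natCast_dvd_natCast.2 (Nat.gcd_dvd_left e g)
  have hg : (Nat.gcd e g : ℤ) ∣ g := Int.natCast_dvd_natCast.2 (Nat.gcd_dvd_right e g)
  have h1 : IsCoprime (x * z) (Nat.gcd e g : ℤ) :=
    (hx.of_mul_right_left.of_isCoprime_of_dvd_right he).mul_left (hz.of_isCoprime_of_dvd_right hg)
  have h2 : u = x * z + (Nat.gcd e g : ℤ) * c := by linarith
  rw [h2]
  exact h1.add_mul_left_left c

end IsCuspWith

theorem eq_or_eq_neg_of_isCoprime_of_mul_eq {a b c d : ℤ} (hab : IsCoprime a b)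
    (hcd : IsCoprime c d) (h : a * d = c * b) :
    ∃ s : ℤ, (s = 1 ∨ s = -1) ∧ c = s * a ∧ d = s * b := by
  obtain ⟨r, t, hrt⟩ := hab
  obtain ⟨r', t', hrt'⟩ := hcd
  have hc : c = (r * c + t * d) * a := by linear_combination -c * hrt - t * h
  have hd : d = (r * c + t * d) * b := by linear_combination -d * hrt + r * h
  refine ⟨r * c + t * d, ?_, hc, hd⟩
  have : (r * c + t * d) * (r' * a + t' * b) = 1 := by
    linear_combination hrt' - r' * hc - t' * hd
  exact Int.isUnit_iff.1 (IsUnit.of_mul_eq_one _ this)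

theorem int_gcd_mul_mul_eq {e g : ℕ} {z : ℤ} (hz : IsCoprime z g) :
    Int.gcd (e * z) (e * g) = e := by
  rw [Int.gcd_mul_left, Int.isCoprime_iff_gcd_eq_one.1 hz]
  simp

namespace IsCuspWith

theorem unique {e g e' g' : ℕ} {u u' : ℤ} {v : Fin 2 → ℚ} (h : IsCuspWith e g u v)
    (h' : IsCuspWith e' g' u' v) (hn : e * g = e' * g') (hpos : 0 < e * g) :
    e = e' ∧ (Nat.gcd e g : ℤ) ∣ u - u' := by
  obtain ⟨x, z, q, hq, hx, hz, rfl, hu⟩ := h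
  obtain ⟨x', z', q', hq', hx', hz', hv, hu'⟩ := h'
  have h0 : q * x = q' * x' := by simpa using congrFun hv 0
  have h1 : q * (e * z) = q' * (e' * z') := by simpa using congrFun hv 1
  have hcross : x * (e' * z') = x' * (e * z) := by
    have : (x : ℚ) * (e' * z') = x' * (e * z) := by
      refine mul_left_cancel₀ (mul_ne_zero hq hq') ?_
      linear_combination q' * (e' * z') * h0 - q' * x' * h1
    exact_mod_cast this
  obtain ⟨s, hs, hxs, hys⟩ := eq_or_eq_neg_of_isCoprime_of_mul_eq hx hx' hcross
  have hss : s * s = 1 := by rcases hs with rfl | rfl <;> norm_num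
  have hn' : (e : ℤ) * g = e' * g' := by exact_mod_cast hn
  have hee : e = e' := by
    calc
      e = Int.gcd (e * z) (e * g) := (int_gcd_mul_mul_eq hz).symm
      _ = Int.gcd (e' * z') (e' * g') := by
        rw [← hn', hys]
        rcases hs with rfl | rfl <;> simp
      _ = e' := int_gcd_mul_mul_eq hz'
  subst hee
  have he : (e : ℤ) ≠ 0 := by
    rintro h
    simp [Int.natCast_eq_zero.1 h] at hpos
  have hzs : z' = s * z := mul_left_cancel₀ he (by linear_combination hys)
  have hgg : g = g' := by
    have := mul_left_cancel₀ he hn'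
    exact_mod_cast this
  subst hgg
  refine ⟨rfl, ?_⟩
  have hxz : x' * z' = x * z := by
    rw [hxs, hzs]
    linear_combination x * z * hss
  rw [hxz] at hu'
  have := dvd_sub hu hu'
  rwa [sub_sub_sub_cancel_right] at this

theorem exists_of_ne_zero {n : ℕ} (hn : 0 < n) {v : Fin 2 → ℚ} (hv : v ≠ 0) :
    ∃ e g : ℕ, ∃ u : ℤ, e * g = n ∧ IsCuspWith e g u v := by
  obtain ⟨X, Y, c, hc, hvc⟩ : ∃ X Y : ℤ, ∃ c : ℚ, c ≠ 0 ∧ v = c • ![(X : ℚ), (Y : ℚ)] := by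
    have h0 : ((v 0).den : ℚ) ≠ 0 := Nat.cast_ne_zero.2 (v 0).den_nz
    have h1 : ((v 1).den : ℚ) ≠ 0 := Nat.cast_ne_zero.2 (v 1).den_nz
    refine ⟨(v 0).num * (v 1).den, (v 1).num * (v 0).den,
      (((v 0).den : ℚ) * (v 1).den)⁻¹, inv_ne_zero (mul_ne_zero h0 h1), ?_⟩
    ext i
    fin_cases i
    · have := Rat.num_div_den (v 0)
      simp only [Fin.zero_eta, Pi.smul_apply, Matrix.cons_val_zero, smul_eq_mul]
      push_cast
      nth_rewrite 1 [← this]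
      field_simp
    · have := Rat.num_div_den (v 1)
      simp only [Fin.mk_one, Pi.smul_apply, Matrix.cons_val_one, smul_eq_mul]
      push_cast
      nth_rewrite 1 [← this]
      field_simp
  have hXY : X ≠ 0 ∨ Y ≠ 0 := by
    by_contra! h
    apply hv
    rw [hvc, h.1, h.2]
    ext i
    fin_cases i <;> simp
  have hpos : 0 < Int.gcd X Y := Int.gcd_pos_iff.2 hXY
  obtain ⟨x, y, hxy, hX, hY⟩ := Int.exists_gcd_one hpos
  have hgpos : 0 < Int.gcd y n := Int.gcd_pos_of_ne_zero_right _ (by exact_mod_cast hn.ne')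
  obtain ⟨z, g, hzg, hz, hg⟩ := Int.exists_gcd_one hgpos
  set e := Int.gcd y n with he
  have hg0 : 0 ≤ g := by
    by_contra! h
    have : (0 : ℤ) < n := by exact_mod_cast hn
    have he' : (0 : ℤ) < e := by exact_mod_cast hgpos
    nlinarith
  lift g to ℕ using hg0
  refine ⟨e, g, x * z, ?_, x, z, c * Int.gcd X Y, ?_, ?_, ?_, ?_, by simp⟩
  · have : (n : ℤ) = g * e := hg
    rw [mul_comm]
    exact_mod_cast this.symm
  · exact mul_ne_zero hc (by exact_mod_cast hpos.ne')
  · rw [mul_comm (e : ℤ), ← hz]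
    exact Int.isCoprime_iff_gcd_eq_one.2 hxy
  · exact Int.isCoprime_iff_gcd_eq_one.2 hzg
  · have hz' : (y : ℚ) = e * z := by
      rw [hz]; push_cast; ring
    rw [hvc, ← hz']
    ext i
    fin_cases i
    · have : (X : ℚ) = x * Int.gcd X Y := by exact_mod_cast hX
      simp only [Fin.zero_eta, Pi.smul_apply, Matrix.cons_val_zero, smul_eq_mul]
      rw [this]; ring
    · have : (Y : ℚ) = y * Int.gcd X Y := by exact_mod_cast hY
      simp only [Fin.mk_one, Pi.smul_apply, Matrix.cons_val_one, Matrix.cons_val_fin_one,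
        smul_eq_mul]
      linear_combination c * this

theorem exists_of_isCoprime {e g : ℕ} (he : 0 < e) {u : ℤ} (hu : IsCoprime u (Nat.gcd e g : ℤ)) :
    ∃ v : {v : Fin 2 → ℚ // v ≠ 0}, IsCuspWith e g u v := by
  have : NeZero e := ⟨he.ne'⟩
  obtain ⟨U, hU⟩ := (ZMod.coe_int_isUnit_iff_isCoprime u (Nat.gcd e g)).2 hu.symm
  obtain ⟨X, hX⟩ := ZMod.unitsMap_surjective (Nat.gcd_dvd_left e g) U
  set x : ℤ := ((X : ZMod e).cast : ℤ) with hx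
  have hxX : (x : ZMod e) = X := ZMod.intCast_zmod_cast _
  have hcop : IsCoprime x e :=
    ((ZMod.coe_int_isUnit_iff_isCoprime x e).1 (hxX ▸ X.isUnit)).symm
  have hmod : ((x : ℤ) : ZMod (Nat.gcd e g)) = u := by
    rw [← hU, ← hX, ZMod.unitsMap_val, ← hxX, ZMod.cast_intCast (Nat.gcd_dvd_left e g)]
  refine ⟨⟨![(x : ℚ), e], ?_⟩, x, 1, 1, one_ne_zero, by simpa using hcop, isCoprime_one_left,
    by simp, ?_⟩
  · intro h
    have : (e : ℚ) = 0 := by simpa using congrFun h 1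
    exact he.ne' (by exact_mod_cast this)
  · rw [mul_one]
    exact (ZMod.intCast_eq_intCast_iff_dvd_sub _ _ _).1 hmod

theorem mulVec_of_inGamma0 {e g : ℕ} {u : ℤ} {v : Fin 2 → ℚ} (h : IsCuspWith e g u v)
    {M : Matrix (Fin 2) (Fin 2) ℚ} (hM : InGamma0 (e * g) M) : IsCuspWith e g u (M.mulVec v) := by
  obtain ⟨x, z, q, hq, hx, hz, rfl, hu⟩ := h
  obtain ⟨a, b, c, d, ⟨c', rfl⟩, hdet, rfl⟩ := hM
  push_cast at hdet
  refine ⟨a * x + b * (e * z), g * (c' * x) + d * z, q, hq, ?_, ?_, ?_, ?_⟩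
  · obtain ⟨r, s, hrs⟩ := hx
    refine ⟨r * d - s * (e * g * c'), s * a - r * b, ?_⟩
    linear_combination hrs + (r * x + s * (e * z)) * hdet
  · have hd : IsCoprime d (g : ℤ) := ⟨a, -(b * e * c'), by linear_combination hdet⟩
    rw [add_comm]
    exact (hd.mul_left hz).add_mul_left_left _
  · ext i
    fin_cases i
    · simp [Matrix.mulVec, dotProduct, Fin.sum_univ_two]
      ring
    · simp [Matrix.mulVec, dotProduct, Fin.sum_univ_two]
      ring
  · have he : (Nat.gcd e g : ℤ) ∣ e := Int.natCast_dvd_natCast.2 (Nat.gcd_dvd_left e g)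
    have hg : (Nat.gcd e g : ℤ) ∣ g := Int.natCast_dvd_natCast.2 (Nat.gcd_dvd_right e g)
    have key : u - (a * x + b * (e * z)) * (g * (c' * x) + d * z) = (u - x * z) -
        (g * (a * c' * x ^ 2) + e * (x * z * b * g * c' + b * z * (g * (c' * x) + d * z))) := by
      linear_combination (-x * z) * hdet
    rw [key]
    exact dvd_sub hu (dvd_add (hg.mul_right _) (he.mul_right _))

theorem mulVec_fricke {e g n : ℕ} (hn : 0 < n) (heg : e * g = n) {u : ℤ} {v : Fin 2 → ℚ}
    (h : IsCuspWith e g u v) :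
    IsCuspWith g e (-u) ((frickeGL n hn : Matrix (Fin 2) (Fin 2) ℚ).mulVec v) := by
  obtain ⟨x, z, q, hq, hx, hz, rfl, hu⟩ := h
  have he : (e : ℚ) ≠ 0 := by
    rintro h
    have : e = 0 := by exact_mod_cast h
    simp [this] at heg
    omega
  refine ⟨-z, x, q * e, mul_ne_zero hq he, ?_, hx.of_mul_right_left, ?_, ?_⟩
  · exact (hz.mul_right hx.of_mul_right_right.symm).neg_left
  · subst heg
    ext i
    fin_cases i
    · simp [frickeGL, Matrix.GeneralLinearGroup.mkOfDetNeZero, Matrix.mulVec, dotProduct,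
        Fin.sum_univ_two]
      ring
    · simp [frickeGL, Matrix.GeneralLinearGroup.mkOfDetNeZero, Matrix.mulVec, dotProduct,
        Fin.sum_univ_two]
      ring
  · rw [Nat.gcd_comm]
    have : -u - -z * x = -(u - x * z) := by ring
    rw [this]
    exact hu.neg_right

theorem exists_inGamma0 {e g : ℕ} {u : ℤ} {v w : Fin 2 → ℚ} (h : IsCuspWith e g u v)
    (h' : IsCuspWith e g u w) :
    ∃ M : Matrix (Fin 2) (Fin 2) ℚ, InGamma0 (e * g) M ∧ ∃ q : ℚ, q ≠ 0 ∧ w = q • M.mulVec v := by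
  obtain ⟨x, z, q, hq, ⟨Q, p, hQ⟩, hz, rfl, hu⟩ := h
  obtain ⟨x', z', q', hq', ⟨Q', p', hQ'⟩, hz', rfl, hu'⟩ := h'
  have he : (Nat.gcd e g : ℤ) ∣ e := Int.natCast_dvd_natCast.2 (Nat.gcd_dvd_left e g)
  have hdvd : (Nat.gcd e g : ℤ) ∣ z' * Q - Q' * z := by
    have h1 : z' * Q - Q' * z = Q * Q' * ((u - x * z) - (u - x' * z')) +
        e * (z' * Q * (p' * z') - Q' * z * (p * z)) := by
      linear_combination (-(z' * Q)) * hQ' + Q' * z * hQ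
    rw [h1]
    exact dvd_add ((dvd_sub hu hu').mul_left _) (he.mul_right _)
  obtain ⟨τ, hτ⟩ := hdvd
  rw [Nat.gcd_eq_gcd_ab] at hτ
  set A := Nat.gcdA e g
  set B := Nat.gcdB e g
  obtain ⟨r, s, hrs⟩ := hz.mul_left hz'
  refine ⟨!![((x' * Q - (r * A * τ * x' - p') * (e * z) : ℤ) : ℚ),
      ((x' * p + (r * A * τ * x' - p') * x : ℤ) : ℚ);
      ((e * z' * Q - (r * A * τ * (e * z') + Q') * (e * z) : ℤ) : ℚ),
      ((e * z' * p + (r * A * τ * (e * z') + Q') * x : ℤ) : ℚ)],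
    ⟨_, _, _, _, ?_, ?_, rfl⟩, q' / q, div_ne_zero hq' hq, ?_⟩
  · refine ⟨e * A * τ * s + B * τ, ?_⟩
    push_cast
    linear_combination e * hτ - e * e * A * τ * hrs
  · linear_combination (Q' * x' + p' * (e * z')) * hQ + hQ'
  · have hQq : (Q : ℚ) * x + p * (e * z) = 1 := by exact_mod_cast hQ
    ext i
    fin_cases i
    · simp
      field_simp
      linear_combination (-(x' : ℚ)) * hQq
    · simp
      field_simp
      linear_combination (-((e : ℚ) * z')) * hQq

end IsCuspWith

theorem InGamma0.exists_mul_eq_one {n : ℕ} {M : Matrix (Fin 2) (Fin 2) ℚ} (hM : InGamma0 n M) :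
    ∃ M' : Matrix (Fin 2) (Fin 2) ℚ, InGamma0 n M' ∧ M' * M = 1 := by
  obtain ⟨a, b, c, d, hc, hdet, rfl⟩ := hM
  have hdet' : (a : ℚ) * d - b * c = 1 := by exact_mod_cast hdet
  refine ⟨_, ⟨d, -b, -c, a, hc.neg_right, by linear_combination hdet, rfl⟩, ?_⟩
  have h00 : (d : ℚ) * a + (-b : ℤ) * c = 1 := by push_cast; linear_combination hdet'
  have h01 : (d : ℚ) * b + (-b : ℤ) * d = 0 := by push_cast; ring
  have h10 : ((-c : ℤ) : ℚ) * a + a * c = 0 := by push_cast; ring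
  have h11 : ((-c : ℤ) : ℚ) * b + a * d = 1 := by push_cast; linear_combination hdet'
  rw [Matrix.mul_fin_two, Matrix.one_fin_two, h00, h01, h10, h11]

theorem isCuspWith_mulVec_iff_of_mem_closure {n : ℕ} (hn : 0 < n) {γ : GL (Fin 2) ℚ}
    (hγ : γ ∈ Subgroup.closure (Gamma0GL n ∪ {frickeGL n hn})) :
    (∀ e g : ℕ, e * g = n → ∀ u v, IsCuspWith e g u v ↔
      IsCuspWith e g u ((γ : Matrix (Fin 2) (Fin 2) ℚ).mulVec v)) ∨
    (∀ e g : ℕ, e * g = n → ∀ u v, IsCuspWith e g u v ↔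
      IsCuspWith g e (-u) ((γ : Matrix (Fin 2) (Fin 2) ℚ).mulVec v)) := by
  induction hγ using Subgroup.closure_induction with
  | mem γ hγ =>
    rcases hγ with hγ | rfl
    · left
      rintro e g rfl u v
      refine ⟨fun h => h.mulVec_of_inGamma0 hγ, fun h => ?_⟩
      obtain ⟨M', hM', hMM⟩ := InGamma0.exists_mul_eq_one hγ
      have := h.mulVec_of_inGamma0 hM'
      rwa [Matrix.mulVec_mulVec, hMM, Matrix.one_mulVec] at this
    · right
      intro e g heg u v
      refine ⟨fun h => h.mulVec_fricke hn heg, fun h => ?_⟩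
      have h2 := h.mulVec_fricke hn (by rw [mul_comm, heg])
      have hn0 : -(n : ℚ) ≠ 0 := neg_ne_zero.2 (Nat.cast_ne_zero.2 hn.ne')
      have hW : (frickeGL n hn : Matrix (Fin 2) (Fin 2) ℚ).mulVec
          ((frickeGL n hn : Matrix (Fin 2) (Fin 2) ℚ).mulVec v) = (-(n : ℚ)) • v := by
        ext i
        fin_cases i <;>
          simp [frickeGL, Matrix.GeneralLinearGroup.mkOfDetNeZero, Matrix.mulVec, dotProduct,
            Fin.sum_univ_two]
      rw [hW, neg_neg] at h2
      have h3 := h2.smul (inv_ne_zero hn0)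
      rwa [smul_smul, inv_mul_cancel₀ hn0, one_smul] at h3
  | one => exact .inl fun e g _ u v => by simp
  | mul a b _ _ ha hb =>
    simp only [Units.val_mul, ← Matrix.mulVec_mulVec]
    rcases ha with ha | ha <;> rcases hb with hb | hb
    · exact .inl fun e g h u v => (hb e g h u v).trans (ha e g h u _)
    · exact .inr fun e g h u v => (hb e g h u v).trans (ha g e (by rw [mul_comm, h]) (-u) _)
    · exact .inr fun e g h u v => (hb e g h u v).trans (ha e g h u _)
    · refine .inl fun e g h u v => (hb e g h u v).trans ?_
      have := ha g e (by rw [mul_comm, h]) (-u) ((b : Matrix (Fin 2) (Fin 2) ℚ).mulVec v)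
      rwa [neg_neg] at this
  | inv a _ ha =>
    have hcancel : ∀ v, (a : Matrix (Fin 2) (Fin 2) ℚ).mulVec
        (((a⁻¹ : GL (Fin 2) ℚ) : Matrix (Fin 2) (Fin 2) ℚ).mulVec v) = v := fun v => by
      rw [Matrix.mulVec_mulVec, Units.mul_inv, Matrix.one_mulVec]
    rcases ha with ha | ha
    · refine .inl fun e g h u v => ?_
      rw [ha e g h u (((a⁻¹ : GL (Fin 2) ℚ) : Matrix (Fin 2) (Fin 2) ℚ).mulVec v), hcancel]
    · refine .inr fun e g h u v => ?_
      rw [ha g e (by rw [mul_comm, h]) (-u)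
        (((a⁻¹ : GL (Fin 2) ℚ) : Matrix (Fin 2) (Fin 2) ℚ).mulVec v), hcancel, neg_neg]

theorem frickeRel_equivalence (n : ℕ) (hn : 0 < n) : Equivalence (frickeRel n hn) where
  refl v := ⟨1, one_mem _, 1, one_ne_zero, by simp⟩
  symm := by
    rintro v w ⟨γ, hγ, q, hq, h⟩
    refine ⟨γ⁻¹, inv_mem hγ, q⁻¹, inv_ne_zero hq, ?_⟩
    rw [h, Matrix.mulVec_smul, Matrix.mulVec_mulVec, Units.inv_mul, Matrix.one_mulVec, smul_smul,
      inv_mul_cancel₀ hq, one_smul]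
  trans := by
    rintro v w x ⟨γ, hγ, q, hq, h⟩ ⟨γ', hγ', q', hq', h'⟩
    refine ⟨γ' * γ, mul_mem hγ' hγ, q' * q, mul_ne_zero hq' hq, ?_⟩
    rw [h', h, Matrix.mulVec_smul, Matrix.mulVec_mulVec, smul_smul, Units.val_mul]

theorem quot_mk_eq_iff_frickeRel {n : ℕ} (hn : 0 < n) (v w : {v : Fin 2 → ℚ // v ≠ 0}) :
    Quot.mk (frickeRel n hn) v = Quot.mk (frickeRel n hn) w ↔ frickeRel n hn v w :=
  ⟨fun h => (frickeRel_equivalence n hn).eqvGen_iff.1 (Quot.eqvGen_exact h), Quot.sound⟩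

namespace IsCuspWith

variable {n e g : ℕ} {u : ℤ} {v w : {v : Fin 2 → ℚ // v ≠ 0}}

theorem of_frickeRel (hn : 0 < n) (heg : e * g = n) (h : IsCuspWith e g u v)
    (hvw : frickeRel n hn v w) : IsCuspWith e g u w ∨ IsCuspWith g e (-u) w := by
  obtain ⟨γ, hγ, q, hq, hw⟩ := hvw
  rw [hw]
  rcases isCuspWith_mulVec_iff_of_mem_closure hn hγ with H | H
  · exact .inl (((H e g heg u v).1 h).smul hq)
  · exact .inr (((H e g heg u v).1 h).smul hq)

theorem frickeRel_of_isCuspWith (hn : 0 < n) (heg : e * g = n) (hv : IsCuspWith e g u v)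
    (hw : IsCuspWith e g u w) : frickeRel n hn v w := by
  obtain ⟨M, hM, q, hq, h⟩ := hv.exists_inGamma0 hw
  rw [heg] at hM
  have hdet : M.det ≠ 0 := by
    obtain ⟨a, b, c, d, -, hd, rfl⟩ := hM
    have hd' : (a : ℚ) * d - b * c = 1 := by exact_mod_cast hd
    rw [Matrix.det_fin_two_of, hd']
    exact one_ne_zero
  exact ⟨Matrix.GeneralLinearGroup.mkOfDetNeZero M hdet,
    Subgroup.subset_closure (.inl hM), q, hq, h⟩

theorem frickeRel_of_neg (hn : 0 < n) (heg : e * g = n) (hv : IsCuspWith e g u v)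
    (hw : IsCuspWith g e (-u) w) : frickeRel n hn v w := by
  have hge : g * e = n := by rw [mul_comm, heg]
  have hne : (frickeGL n hn : Matrix (Fin 2) (Fin 2) ℚ).mulVec v ≠ 0 := fun h => by
    refine v.2 ?_
    have := congrArg (((frickeGL n hn)⁻¹ : GL (Fin 2) ℚ) : Matrix (Fin 2) (Fin 2) ℚ).mulVec h
    rwa [Matrix.mulVec_mulVec, Units.inv_mul, Matrix.one_mulVec, Matrix.mulVec_zero] at this
  refine (frickeRel_equivalence n hn).trans
    (y := ⟨(frickeGL n hn : Matrix (Fin 2) (Fin 2) ℚ).mulVec v, hne⟩) ?_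
    ((hv.mulVec_fricke hn heg).frickeRel_of_isCuspWith hn hge hw)
  exact ⟨frickeGL n hn, Subgroup.subset_closure (.inr rfl), 1, one_ne_zero, by simp⟩

end IsCuspWith

theorem isCoprime_cast_unit {m : ℕ} (U : (ZMod m)ˣ) : IsCoprime ((U : ZMod m).cast : ℤ) m := by
  refine ((ZMod.coe_int_isUnit_iff_isCoprime _ m).1 ?_).symm
  rw [ZMod.intCast_zmod_cast]
  exact U.isUnit

theorem exists_unit_dvd_cast_sub {m : ℕ} {u : ℤ} (hu : IsCoprime u m) :
    ∃ U : (ZMod m)ˣ, (m : ℤ) ∣ ((U : ZMod m).cast : ℤ) - u := by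
  obtain ⟨U, hU⟩ := (ZMod.coe_int_isUnit_iff_isCoprime u m).2 hu.symm
  refine ⟨U, (ZMod.intCast_eq_intCast_iff_dvd_sub _ _ _).1 ?_⟩
  rw [ZMod.intCast_zmod_cast, hU]

theorem unit_eq_of_dvd_cast_sub {m : ℕ} {U V : (ZMod m)ˣ}
    (h : (m : ℤ) ∣ ((U : ZMod m).cast : ℤ) - ((V : ZMod m).cast : ℤ)) : V = U := by
  have := (ZMod.intCast_eq_intCast_iff_dvd_sub _ _ _).2 h
  rw [ZMod.intCast_zmod_cast, ZMod.intCast_zmod_cast] at this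
  exact Units.ext this

theorem dvd_cast_neg_unit_add {m : ℕ} (U : (ZMod m)ˣ) :
    (m : ℤ) ∣ (((-U : (ZMod m)ˣ) : ZMod m).cast : ℤ) - -((U : ZMod m).cast : ℤ) := by
  rw [← ZMod.intCast_eq_intCast_iff_dvd_sub]
  simp

/-- Pairs of a divisor `e` of `n` with `e ^ 2 < n` and a unit modulo `gcd(e, n / e)`. They index
the orbits of cusps of `Γ₀(n)` whose divisor is not fixed by the Fricke involution `e ↦ n / e`. -/
abbrev SmallCusp (n : ℕ) : Type :=
  Σ e : {e // e ∈ n.divisors.filter (fun e => e ^ 2 < n)}, (ZMod (Nat.gcd e (n / e)))ˣ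

/-- The orbits of negation on `(ℤ/dℤ)ˣ` if `n = d ^ 2` is a perfect square, the empty type
otherwise. -/
abbrev MiddleCusp (n : ℕ) : Type :=
  {_b : Quot (fun u v : (ZMod (Nat.sqrt n))ˣ => v = u ∨ v = -u) // Nat.sqrt n ^ 2 = n}

theorem gcd_div_pos {n e : ℕ} (hn : 0 < n) (he : e ∣ n) : 0 < Nat.gcd e (n / e) :=
  Nat.gcd_pos_of_pos_left _ (Nat.pos_of_dvd_of_pos he hn)

theorem finite_smallCusp {n : ℕ} (hn : 0 < n) : Finite (SmallCusp n) := by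
  have (e : {e // e ∈ n.divisors.filter (fun e => e ^ 2 < n)}) :
      Finite (ZMod (Nat.gcd e (n / e)))ˣ := by
    have : NeZero (Nat.gcd e (n / e)) :=
      ⟨(gcd_div_pos hn (Nat.dvd_of_mem_divisors (Finset.mem_filter.1 e.2).1)).ne'⟩
    infer_instance
  infer_instance

theorem card_smallCusp {n : ℕ} (hn : 0 < n) :
    Nat.card (SmallCusp n) =
      ∑ e ∈ n.divisors.filter (fun e => e ^ 2 < n), (Nat.gcd e (n / e)).totient := by
  have hne (e : {e // e ∈ n.divisors.filter (fun e => e ^ 2 < n)}) :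
      NeZero (Nat.gcd e (n / e)) :=
    ⟨(gcd_div_pos hn (Nat.dvd_of_mem_divisors (Finset.mem_filter.1 e.2).1)).ne'⟩
  rw [Nat.card_sigma,
    ← Finset.sum_coe_sort _ (fun e => (Nat.gcd e (n / e)).totient)]
  refine Finset.sum_congr rfl fun e _ => ?_
  rw [Nat.card_eq_fintype_card, ZMod.card_units_eq_totient]

theorem finite_middleCusp {n : ℕ} (hn : 0 < n) : Finite (MiddleCusp n) := by
  have : NeZero (Nat.sqrt n) := ⟨(Nat.sqrt_pos.2 hn).ne'⟩
  infer_instance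

theorem card_middleCusp (n : ℕ) :
    Nat.card (MiddleCusp n) = if Nat.sqrt n ^ 2 = n then
      Nat.card (Quot (fun u v : (ZMod (Nat.sqrt n))ˣ => v = u ∨ v = -u)) else 0 := by
  split_ifs with h
  · exact Nat.card_congr (Equiv.subtypeUnivEquiv fun _ => h)
  · have : IsEmpty (MiddleCusp n) := ⟨fun b => h b.2⟩
    exact Nat.card_of_isEmpty

theorem exists_bijective_cusps (n : ℕ) (hn : 0 < n) :
    ∃ f : SmallCusp n ⊕ MiddleCusp n → Quot (frickeRel n hn), Function.Bijective f := by
  have hsmall : ∀ c : SmallCusp n, ∃ v : {v : Fin 2 → ℚ // v ≠ 0},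
      IsCuspWith c.1 (n / c.1) ((c.2 : ZMod (Nat.gcd c.1 (n / c.1))).cast : ℤ) v := fun c =>
    IsCuspWith.exists_of_isCoprime
      (Nat.pos_of_mem_divisors (Finset.mem_filter.1 c.1.2).1) (isCoprime_cast_unit c.2)
  have hmiddle : ∀ U : (ZMod (Nat.sqrt n))ˣ, ∃ v : {v : Fin 2 → ℚ // v ≠ 0},
      IsCuspWith (Nat.sqrt n) (Nat.sqrt n) ((U : ZMod (Nat.sqrt n)).cast : ℤ) v := fun U =>
    IsCuspWith.exists_of_isCoprime (Nat.sqrt_pos.2 hn)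
      (by rw [Nat.gcd_self]; exact isCoprime_cast_unit U)
  choose vs hvs using hsmall
  choose vm hvm using hmiddle
  have hmul : ∀ c : SmallCusp n, (c.1 : ℕ) * (n / c.1) = n := fun c =>
    Nat.mul_div_cancel' (Nat.dvd_of_mem_divisors (Finset.mem_filter.1 c.1.2).1)
  have hlt : ∀ c : SmallCusp n, (c.1 : ℕ) ^ 2 < n := fun c => (Finset.mem_filter.1 c.1.2).2
  let m : MiddleCusp n → Quot (frickeRel n hn) := fun b =>
    Quot.lift (fun U => Quot.mk (frickeRel n hn) (vm U)) (by
      rintro U V (rfl | rfl)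
      · rfl
      · have hs : Nat.sqrt n * Nat.sqrt n = n := by rw [← sq, b.2]
        refine Quot.sound ((hvm U).frickeRel_of_neg hn hs ((hvm (-U)).of_dvd_sub ?_))
        rw [Nat.gcd_self, ← dvd_neg, neg_sub]
        exact dvd_cast_neg_unit_add U) b.1
  refine ⟨Sum.elim (fun c => Quot.mk _ (vs c)) m, ?_, ?_⟩
  · have hsm : ∀ (c : SmallCusp n) (b : MiddleCusp n), Quot.mk _ (vs c) ≠ m b := by
      rintro c ⟨⟨U⟩, hs⟩ h
      have hs' : Nat.sqrt n * Nat.sqrt n = n := by rw [← sq, hs]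
      have hrel := (quot_mk_eq_iff_frickeRel hn (vm U) (vs c)).1 h.symm
      have hl := hlt c
      have hm := hmul c
      rcases (hvm U).of_frickeRel hn hs' hrel with h1 | h1 <;>
      · have := (h1.unique (hvs c) (by rw [hs', hm]) (by rwa [hs'])).1
        rw [← this, hs] at hl
        exact lt_irrefl _ hl
    refine Function.Injective.sumElim ?_ ?_ hsm
    · rintro c c' h
      have hrel := (quot_mk_eq_iff_frickeRel hn _ _).1 h
      have hm := hmul c
      have hm' := hmul c'
      have hl := hlt c
      have hl' := hlt c'
      rcases (hvs c).of_frickeRel hn hm hrel with h1 | h1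
      · obtain ⟨he, hu⟩ := h1.unique (hvs c') (by rw [hm, hm']) (by rwa [hm])
        obtain ⟨⟨e, _⟩, U⟩ := c
        obtain ⟨⟨e', _⟩, U'⟩ := c'
        dsimp only at he
        subst he
        exact congrArg (Sigma.mk _) (unit_eq_of_dvd_cast_sub hu).symm
      · have he := (h1.unique (hvs c') (by rw [mul_comm, hm, hm']) (by rwa [mul_comm, hm])).1
        rw [← he] at hl'
        exfalso
        have : (c.1 : ℕ) < n / c.1 := by nlinarith
        nlinarith
    · rintro ⟨⟨U⟩, hs⟩ ⟨⟨V⟩, _⟩ h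
      have hs' : Nat.sqrt n * Nat.sqrt n = n := by rw [← sq, hs]
      have hrel := (quot_mk_eq_iff_frickeRel hn (vm U) (vm V)).1 h
      refine Subtype.ext (Quot.sound ?_)
      rcases (hvm U).of_frickeRel hn hs' hrel with h1 | h1
      · have hu := (h1.unique (hvm V) rfl (by rwa [hs'])).2
        rw [Nat.gcd_self] at hu
        exact .inl (unit_eq_of_dvd_cast_sub hu)
      · have hu := (h1.unique (hvm V) rfl (by rwa [hs'])).2
        rw [Nat.gcd_self] at hu
        refine .inr (unit_eq_of_dvd_cast_sub ?_)
        have := dvd_add (dvd_cast_neg_unit_add U) hu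
        rwa [sub_add_sub_cancel] at this
  · rintro ⟨v⟩
    obtain ⟨e, g, u, heg, hv⟩ := IsCuspWith.exists_of_ne_zero hn v.2
    have he0 : 0 < e := Nat.pos_of_ne_zero (by rintro rfl; simp at heg; omega)
    have hg0 : 0 < g := Nat.pos_of_ne_zero (by rintro rfl; simp at heg; omega)
    have hcop := hv.isCoprime
    rcases lt_trichotomy e g with hlt | rfl | hlt
    · obtain ⟨U, hU⟩ := exists_unit_dvd_cast_sub hcop
      obtain rfl : g = n / e := (Nat.div_eq_of_eq_mul_right he0 heg.symm).symm
      have hmem : e ∈ n.divisors.filter (fun e => e ^ 2 < n) := by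
        refine Finset.mem_filter.2 ⟨Nat.mem_divisors.2 ⟨⟨_, heg.symm⟩, hn.ne'⟩, ?_⟩
        nlinarith
      exact ⟨.inl ⟨⟨e, hmem⟩, U⟩,
        Quot.sound ((hvs ⟨⟨e, hmem⟩, U⟩).frickeRel_of_isCuspWith hn heg (hv.of_dvd_sub hU))⟩
    · have hsq : Nat.sqrt n = e := by rw [← heg, Nat.sqrt_eq]
      subst hsq
      rw [Nat.gcd_self] at hcop
      obtain ⟨U, hU⟩ := exists_unit_dvd_cast_sub hcop
      refine ⟨.inr ⟨Quot.mk _ U, by rw [sq, heg]⟩, ?_⟩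
      exact Quot.sound ((hvm U).frickeRel_of_isCuspWith hn heg (hv.of_dvd_sub (by rwa [Nat.gcd_self])))
    · rw [Nat.gcd_comm] at hcop
      obtain ⟨U, hU⟩ := exists_unit_dvd_cast_sub hcop.neg_left
      have hge : g * e = n := by rw [mul_comm, heg]
      obtain rfl : e = n / g := (Nat.div_eq_of_eq_mul_right hg0 hge.symm).symm
      have hmem : g ∈ n.divisors.filter (fun e => e ^ 2 < n) := by
        refine Finset.mem_filter.2 ⟨Nat.mem_divisors.2 ⟨⟨_, hge.symm⟩, hn.ne'⟩, ?_⟩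
        nlinarith
      refine ⟨.inl ⟨⟨g, hmem⟩, U⟩, Quot.sound ?_⟩
      refine (hvs ⟨⟨g, hmem⟩, U⟩).frickeRel_of_neg hn hge (hv.of_dvd_sub ?_)
      rw [Nat.gcd_comm, ← dvd_neg, neg_sub, sub_neg_eq_add, add_comm]
      rwa [sub_neg_eq_add] at hU

/-- the group generated by `Γ₀(n)` and the Fricke matrix has finitely
many orbits on `ℙ¹(ℚ)`, and the number of orbits equals
`∑_{d² ∣ n, d² < n} φ(d)·2^{ω(n/d²) − 1} + s(n)`, where `s(n)` is the number of orbits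
of negation on `(ℤ/dℤ)^×` if `n = d²` is a perfect square, and `0` otherwise. -/
theorem stmt_14 (n : ℕ) (hn : 0 < n) :
    Finite (Quot (frickeRel n hn)) ∧
    Nat.card (Quot (frickeRel n hn)) =
      (∑ d ∈ (Finset.range (n + 1)).filter (fun d => d ^ 2 ∣ n ∧ d ^ 2 < n),
        d.totient * 2 ^ ((n / d ^ 2).primeFactors.card - 1)) +
      (if Nat.sqrt n ^ 2 = n then
        Nat.card (Quot (fun u v : (ZMod (Nat.sqrt n))ˣ => v = u ∨ v = -u))
      else 0) := by
  obtain ⟨f, hf⟩ := exists_bijective_cusps n hn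
  have := finite_smallCusp hn
  have := finite_middleCusp hn
  refine ⟨Finite.of_surjective f hf.2, ?_⟩
  rw [← Nat.card_eq_of_bijective f hf, Nat.card_sum, card_smallCusp hn, card_middleCusp,
    sum_totient_gcd_div n hn]
end
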